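/- Let m and n be positive integers with m ≤ n and let ℓ₁ and ℓ₂ be positive definite integral quadratic forms of rank m (not necessarily even). Then the pair (ℓ₁, ℓ₂) is buried in rank n over ℤ_p for every prime p (i.e., for every prime p there exists a symmetric K ∈ M_n(ℤ_p) with det K ≠ 0 and matrices T₁, T₂ ∈ M_{n×m}(ℤ_p) with T_iᵀ K T_i = ℓ_i) if and only if the pair is buried in a genus of rank n, i.e., there exist positive definite integral quadratic forms L and L′ of rank n lying in the same genus such that ℓ₁ is represented by L and ℓ₂ is represented by L′. -/

import Mathlib

open Matrix

/-- A positive definite integral quadratic form of rank `m`. -/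
def IsPDForm {m : ℕ} (M : Matrix (Fin m) (Fin m) ℤ) : Prop :=
  M.IsSymm ∧ ∀ x : Fin m → ℤ, x ≠ 0 → 0 < x ⬝ᵥ M.mulVec x

/-- `N` is represented by `L` if `Tᵀ L T = N` for some integer matrix `T`. -/
def Represents {n m : ℕ} (L : Matrix (Fin n) (Fin n) ℤ)
    (N : Matrix (Fin m) (Fin m) ℤ) : Prop :=
  ∃ T : Matrix (Fin n) (Fin m) ℤ, Tᵀ * L * T = N

/-- An integer `a` is represented by the form `M`. -/
def RepresentsInt {m : ℕ} (M : Matrix (Fin m) (Fin m) ℤ) (a : ℤ) : Prop :=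
  ∃ x : Fin m → ℤ, x ⬝ᵥ M.mulVec x = a

/-- Two integral forms of rank `n` are isometric. -/
def IsomForm {n : ℕ} (A B : Matrix (Fin n) (Fin n) ℤ) : Prop :=
  ∃ U : Matrix (Fin n) (Fin n) ℤ, IsUnit U.det ∧ Uᵀ * A * U = B


/-- The pair (ℓ₁, ℓ₂) of integral forms of rank m is buried in rank n over the
commutative ring R: some nondegenerate symmetric n×n matrix over R represents
both ℓ₁ and ℓ₂ over R. -/
def BuriedIn (R : Type*) [CommRing R] {m : ℕ} (n : ℕ)
    (ℓ₁ ℓ₂ : Matrix (Fin m) (Fin m) ℤ) : Prop :=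
  ∃ L : Matrix (Fin n) (Fin n) R, L.IsSymm ∧ L.det ≠ 0 ∧
    (∃ T : Matrix (Fin n) (Fin m) R, Tᵀ * L * T = ℓ₁.map (Int.cast : ℤ → R)) ∧
    (∃ T : Matrix (Fin n) (Fin m) R, Tᵀ * L * T = ℓ₂.map (Int.cast : ℤ → R))

/-- Two integral forms of rank n lie in the same genus: they are equivalent over ℤ_p
for every prime p (and both are positive definite, which is assumed separately). -/
def SameGenus {n : ℕ} (L L' : Matrix (Fin n) (Fin n) ℤ) : Prop :=
  ∀ (p : ℕ) [Fact p.Prime], ∃ U : Matrix (Fin n) (Fin n) ℤ_[p],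
    IsUnit U.det ∧ Uᵀ * L.map (Int.cast : ℤ → ℤ_[p]) * U = L'.map (Int.cast : ℤ → ℤ_[p])


set_option linter.unusedSectionVars false
set_option linter.unusedSimpArgs false
set_option linter.style.haveILetI false
open Matrix

section PartA
variable {F V : Type*} [Field F] [DecidableEq F] [AddCommGroup V] [Module F V]

/-- Orthogonal anisotropic family. -/
def OrthFam (B : LinearMap.BilinForm F V) {n : ℕ} (e : Fin n → V) : Prop :=
  (∀ i j, i ≠ j → B (e i) (e j) = 0) ∧ ∀ i, B (e i) (e i) ≠ 0

/-- A function on a field additive on the Grothendieck-Witt relations. -/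
def GWFun (γ : F → ZMod 8) : Prop :=
  (∀ a s : F, a ≠ 0 → s ≠ 0 → γ (a * s ^ 2) = γ a) ∧
  (∀ a b : F, a ≠ 0 → b ≠ 0 → a + b ≠ 0 → γ a + γ b = γ (a + b) + γ (a * b * (a + b)))

theorem binary_inv {γ : F → ZMod 8} (hγ : GWFun γ) (a b x y : F) (ha : a ≠ 0) (hb : b ≠ 0)
    (hx : x ≠ 0) (hy : y ≠ 0) (hs : a * x ^ 2 + b * y ^ 2 ≠ 0) :
    γ (a * x ^ 2 + b * y ^ 2) + γ (a * b * (a * x ^ 2 + b * y ^ 2)) = γ a + γ b := by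
  have h := hγ.2 (a * x ^ 2) (b * y ^ 2) (by positivity) (by positivity) hs
  rw [hγ.1 a x ha hx, hγ.1 b y hb hy] at h
  rw [h]
  congr 1
  rw [← hγ.1 (a * b * (a * x ^ 2 + b * y ^ 2)) (x * y)
    (mul_ne_zero (mul_ne_zero ha hb) hs) (mul_ne_zero hx hy)]
  congr 1
  ring

theorem sum_split2 {M : Type*} [AddCommGroup M] {n : ℕ} {i j : Fin n} (hij : i ≠ j)
    (g : Fin n → M) :
    ∑ l, g l = g i + g j + ∑ l ∈ (Finset.univ.erase i).erase j, g l := by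
  rw [← Finset.add_sum_erase _ _ (Finset.mem_univ i),
    ← Finset.add_sum_erase _ _ (Finset.mem_erase.2 ⟨hij.symm, Finset.mem_univ j⟩), add_assoc]

theorem orth_step {γ : F → ZMod 8} (hγ : GWFun γ) (h2 : (2 : F) ≠ 0)
    (B : LinearMap.BilinForm F V) (hB : ∀ x y, B x y = B y x) {n : ℕ} :
    ∀ (k : ℕ) (e : Fin (n + 1) → V) (x : Fin (n + 1) → F),
      OrthFam B e → (Finset.univ.filter fun i => x i ≠ 0).card = k →
      B (∑ i, x i • e i) (∑ i, x i • e i) ≠ 0 →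
      ∃ e' : Fin (n + 1) → V, OrthFam B e' ∧ (∀ i, e i ∈ Submodule.span F (Set.range e')) ∧
        ∑ i, γ (B (e' i) (e' i)) = ∑ i, γ (B (e i) (e i)) ∧ e' 0 = ∑ i, x i • e i := by
  intro k
  induction k using Nat.strong_induction_on with
  | _ k ih =>
  intro e x he hk hQ
  have hQsum : B (∑ i, x i • e i) (∑ i, x i • e i) = ∑ i, x i ^ 2 * B (e i) (e i) := by
    simp only [map_sum, LinearMap.sum_apply, map_smul, LinearMap.smul_apply, smul_eq_mul]
    refine Finset.sum_congr rfl fun i _ => ?_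
    rw [Finset.sum_eq_single i]
    · ring
    · intro j _ hj
      rw [he.1 _ _ hj]; ring
    · simp
  by_cases hpair : ∃ i j, i ≠ j ∧ x i ≠ 0 ∧ x j ≠ 0 ∧
      B (e i) (e i) * x i ^ 2 + B (e j) (e j) * x j ^ 2 ≠ 0
  · obtain ⟨i, j, hij, hxi, hxj, hs⟩ := hpair
    set a := B (e i) (e i) with ha
    set b := B (e j) (e j) with hb
    have ha0 : a ≠ 0 := he.2 i
    have hb0 : b ≠ 0 := he.2 j
    set v := x i • e i + x j • e j with hv
    set w := (b * x j) • e i - (a * x i) • e j with hw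
    have hBij : B (e i) (e j) = 0 := he.1 i j hij
    have hBji : B (e j) (e i) = 0 := he.1 j i hij.symm
    have hvv : B v v = a * x i ^ 2 + b * x j ^ 2 := by
      simp only [hv, map_add, map_smul, LinearMap.add_apply, LinearMap.smul_apply, smul_eq_mul,
        hBij, hBji, ← ha, ← hb]; ring
    have hww : B w w = a * b * (a * x i ^ 2 + b * x j ^ 2) := by
      simp only [hw, map_sub, map_smul, LinearMap.sub_apply, LinearMap.smul_apply, smul_eq_mul,
        hBij, hBji, ← ha, ← hb]; ring
    have hvw : B v w = 0 := by
      simp only [hv, hw, map_add, map_sub, map_smul, LinearMap.add_apply,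
        LinearMap.smul_apply, smul_eq_mul,
        hBij, hBji, ← ha, ← hb]; ring
    have hvl : ∀ l, l ≠ i → l ≠ j → B v (e l) = 0 := by
      intro l hli hlj
      simp [hv, he.1 i l hli.symm, he.1 j l hlj.symm]
    have hwl : ∀ l, l ≠ i → l ≠ j → B w (e l) = 0 := by
      intro l hli hlj
      simp [hw, he.1 i l hli.symm, he.1 j l hlj.symm]
    let e1 : Fin (n + 1) → V := fun l => if l = i then v else if l = j then w else e l
    let x1 : Fin (n + 1) → F := fun l => if l = i then 1 else if l = j then 0 else x l
    have e1i : e1 i = v := by simp [e1]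
    have e1j : e1 j = w := by simp [e1, hij.symm]
    have e1l : ∀ l, l ≠ i → l ≠ j → e1 l = e l := by intro l h1 h2; simp [e1, h1, h2]
    have he1 : OrthFam B e1 := by
      constructor
      · intro l r hlr
        by_cases h1 : l = i
        · subst h1
          by_cases h3 : r = j
          · subst h3; rw [e1i, e1j, hvw]
          · rw [e1i, e1l r hlr.symm h3, hvl r hlr.symm h3]
        · by_cases h3 : l = j
          · subst h3
            by_cases h4 : r = i
            · subst h4; rw [e1i, e1j, hB, hvw]
            · rw [e1j, e1l r h4 hlr.symm, hwl r h4 hlr.symm]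
          · rw [e1l l h1 h3]
            by_cases h4 : r = i
            · subst h4; rw [e1i, hB, hvl l h1 h3]
            · by_cases h5 : r = j
              · subst h5; rw [e1j, hB, hwl l h1 h3]
              · rw [e1l r h4 h5, he.1 l r hlr]
      · intro l
        by_cases h1 : l = i
        · subst h1; rw [e1i, hvv]; exact hs
        · by_cases h3 : l = j
          · subst h3; rw [e1j, hww]; exact mul_ne_zero (mul_ne_zero ha0 hb0) hs
          · rw [e1l l h1 h3]; exact he.2 l
    have hrest : ∀ l ∈ (Finset.univ.erase i).erase j, l ≠ i ∧ l ≠ j := by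
      intro l hl; simp at hl; tauto
    have hsum : ∑ l, x1 l • e1 l = ∑ l, x l • e l := by
      rw [sum_split2 hij, sum_split2 hij (fun l => _), e1i, e1j]
      have : x1 i = 1 := by simp [x1]
      rw [this]
      have : x1 j = 0 := by simp [x1, hij.symm]
      rw [this, one_smul, zero_smul, add_zero]
      congr 1
      refine Finset.sum_congr rfl fun l hl => ?_
      obtain ⟨h1, h3⟩ := hrest l hl
      rw [e1l l h1 h3]; simp [x1, h1, h3]
    have hγs : ∑ l, γ (B (e1 l) (e1 l)) = ∑ l, γ (B (e l) (e l)) := by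
      rw [sum_split2 hij, sum_split2 hij (fun l => _), e1i, e1j, hvv, hww, binary_inv hγ a b _ _ ha0 hb0 hxi hxj hs]
      congr 1
      refine Finset.sum_congr rfl fun l hl => ?_
      obtain ⟨h1, h3⟩ := hrest l hl
      rw [e1l l h1 h3]
    have hcard : (Finset.univ.filter fun l => x1 l ≠ 0).card < k := by
      rw [← hk]
      apply Finset.card_lt_card
      rw [Finset.ssubset_iff_of_subset]
      · exact ⟨j, by simp [hxj], by simp [x1, hij.symm]⟩
      · intro l hl
        simp only [Finset.mem_filter, Finset.mem_univ, true_and] at hl ⊢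
        by_cases h1 : l = i
        · rw [h1]; exact hxi
        · by_cases h3 : l = j
          · rw [h3]; exact hxj
          · simpa [x1, h1, h3] using hl
    obtain ⟨e', h1, h3, h4, h5⟩ := ih _ hcard e1 x1 he1 rfl (by rw [hsum]; exact hQ)
    refine ⟨e', h1, ?_, h4.trans hγs, h5.trans hsum⟩
    have hvm : v ∈ Submodule.span F (Set.range e') := e1i ▸ h3 i
    have hwm : w ∈ Submodule.span F (Set.range e') := e1j ▸ h3 j
    intro l
    by_cases h6 : l = i
    · have : e l = (a * x i ^ 2 + b * x j ^ 2)⁻¹ • ((a * x i) • v + x j • w) := by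
        rw [eq_inv_smul_iff₀ hs, h6, hv, hw]; module
      rw [this]
      exact Submodule.smul_mem _ _ (Submodule.add_mem _ (Submodule.smul_mem _ _ hvm)
        (Submodule.smul_mem _ _ hwm))
    · by_cases h7 : l = j
      · have : e l = (a * x i ^ 2 + b * x j ^ 2)⁻¹ • ((b * x j) • v - x i • w) := by
          rw [eq_inv_smul_iff₀ hs, h7, hv, hw]; module
        rw [this]
        exact Submodule.smul_mem _ _ (Submodule.sub_mem _ (Submodule.smul_mem _ _ hvm)
          (Submodule.smul_mem _ _ hwm))
      · rw [← e1l l h6 h7]; exact h3 l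
  · -- at most one nonzero coordinate
    push Not at hpair
    obtain ⟨i, hxi⟩ : ∃ i, x i ≠ 0 := by
      by_contra h
      push Not at h
      apply hQ; simp [h]
    have hothers : ∀ j, j ≠ i → x j = 0 := by
      intro j hj
      by_contra hxj
      have hij := hpair i j hj.symm hxi hxj
      by_cases h3 : ∃ l, l ≠ i ∧ l ≠ j ∧ x l ≠ 0
      · obtain ⟨l, hli, hlj, hxl⟩ := h3
        have h4 := hpair i l hli.symm hxi hxl
        have h5 := hpair j l hlj.symm hxj hxl
        have : 2 * (B (e i) (e i) * x i ^ 2) = 0 := by linear_combination hij + h4 - h5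
        have hh := he.2 i
        simp [h2, hh, hxi] at this
      · push Not at h3
        apply hQ
        rw [hQsum, ← Finset.add_sum_erase _ _ (Finset.mem_univ i),
          ← Finset.add_sum_erase _ _ (Finset.mem_erase.2 ⟨hj, Finset.mem_univ j⟩),
          Finset.sum_eq_zero, ]
        · linear_combination hij
        · intro l hl
          simp at hl
          rw [h3 l hl.2 hl.1]; ring
    have hsum : ∑ l, x l • e l = x i • e i := by
      rw [Finset.sum_eq_single i]
      · intro j _ hj; simp [hothers j hj]
      · simp
    let e0 : Fin (n + 1) → V := fun l => if l = i then x i • e i else e l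
    have e0i : e0 i = x i • e i := by simp [e0]
    have e0l : ∀ l, l ≠ i → e0 l = e l := by intro l hl; simp [e0, hl]
    have hγ0 : ∀ l, γ (B (e0 l) (e0 l)) = γ (B (e l) (e l)) := by
      intro l
      by_cases hl : l = i
      · subst hl
        rw [e0i, ← hγ.1 _ _ (he.2 l) hxi]
        simp only [map_smul, LinearMap.smul_apply, smul_eq_mul]
        congr 1; ring
      · rw [e0l l hl]
    have he0 : OrthFam B e0 := by
      constructor
      · intro l r hlr
        have := he.1 l r hlr
        by_cases h1 : l = i <;> by_cases h3 : r = i <;> simp_all [e0]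
      · intro l
        have := he.2 l
        by_cases h1 : l = i
        · subst h1; rw [e0i]; simp [hxi, this]
        · rw [e0l l h1]; exact this
    refine ⟨e0 ∘ Equiv.swap 0 i, ⟨?_, ?_⟩, ?_, ?_, ?_⟩
    · intro l r hlr; exact he0.1 _ _ (by simpa using hlr)
    · intro l; exact he0.2 _
    · intro l
      rw [Set.range_comp, (Equiv.swap 0 i).range_eq_univ, Set.image_univ]
      by_cases hl : l = i
      · have : e l = (x i)⁻¹ • e0 i := by rw [e0i, hl, inv_smul_smul₀ hxi]
        rw [this]
        exact Submodule.smul_mem _ _ (Submodule.subset_span ⟨i, rfl⟩)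
      · rw [← e0l l hl]; exact Submodule.subset_span ⟨l, rfl⟩
    · rw [← Finset.sum_congr rfl fun l _ => hγ0 l]
      exact Equiv.sum_comp (Equiv.swap 0 i) fun l => γ (B (e0 l) (e0 l))
    · simp [hsum, e0i]

theorem orth_inv {γ : F → ZMod 8} (hγ : GWFun γ) (h2 : (2 : F) ≠ 0)
    (B : LinearMap.BilinForm F V) (hB : ∀ x y, B x y = B y x) :
    ∀ (n : ℕ) (e f : Fin n → V), OrthFam B e → OrthFam B f →
      (∀ i, f i ∈ Submodule.span F (Set.range e)) →
      ∑ i, γ (B (e i) (e i)) = ∑ i, γ (B (f i) (f i)) := by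
  intro n
  induction n with
  | zero => intros; simp
  | succ n ih =>
    intro e f he hf hfe
    obtain ⟨x, hx⟩ := (Submodule.mem_span_range_iff_exists_fun F).1 (hfe 0)
    obtain ⟨e', h1, h3, h4, h5⟩ := orth_step hγ h2 B hB _ e x he rfl (by rw [hx]; exact hf.2 0)
    rw [hx] at h5
    have hfe' : ∀ i, f i ∈ Submodule.span F (Set.range e') := by
      intro i
      refine (Submodule.span_le.2 ?_) (hfe i)
      rintro _ ⟨j, rfl⟩; exact h3 j
    rw [← h4, Fin.sum_univ_succ, Fin.sum_univ_succ, h5]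
    congr 1
    refine ih (fun i => e' i.succ) (fun i => f i.succ) ⟨?_, fun i => h1.2 _⟩
      ⟨?_, fun i => hf.2 _⟩ ?_
    · intro i j hij; exact h1.1 _ _ (by simpa using hij)
    · intro i j hij; exact hf.1 _ _ (by simpa using hij)
    · intro i
      obtain ⟨c, hc⟩ := (Submodule.mem_span_range_iff_exists_fun F).1 (hfe' i.succ)
      have h6 : B (f i.succ) (e' 0) = 0 := by rw [h5]; exact hf.1 _ _ (Fin.succ_ne_zero i)
      have h7 : c 0 * B (e' 0) (e' 0) = 0 := by
        rw [← h6, ← hc]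
        simp only [map_sum, LinearMap.sum_apply, map_smul, LinearMap.smul_apply, smul_eq_mul]
        rw [Finset.sum_eq_single 0]
        · intro j _ hj; rw [h1.1 _ _ hj, mul_zero]
        · simp
      have h8 : c 0 = 0 := by simpa [h1.2 0] using h7
      rw [← hc, Fin.sum_univ_succ, h8, zero_smul, zero_add]
      exact Submodule.sum_mem _ fun j _ => Submodule.smul_mem _ _
        (Submodule.subset_span ⟨j, rfl⟩)
end PartA
set_option linter.unusedSimpArgs false

section PartB
variable (p : ℕ) [hp : Fact p.Prime]

/-- the local function in terms of parity of valuation and unit part -/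
noncomputable def gam0 (v : ℤ) (u : ℤ_[p]) : ZMod 8 :=
  if p = 2 then
    (ZMod.cast (PadicInt.toZModPow 3 u) : ZMod 8) +
      (if Even v then 0 else
        if ((ZMod.cast (PadicInt.toZModPow 3 u) : ZMod 8) = 1 ∨
           (ZMod.cast (PadicInt.toZModPow 3 u) : ZMod 8) = 7) then 0 else 4)
  else
    if Even v then 0 else
      ((3 - (p : ℤ) - 2 * quadraticChar (ZMod p) (PadicInt.toZMod u) : ℤ) : ZMod 8)

/-- unit part -/
noncomputable def upart (x : ℚ_[p]) : ℤ_[p] :=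
  open Classical in
  if h : ∃ y : ℤ_[p], (y : ℚ_[p]) = x * (p : ℚ_[p]) ^ (-x.valuation) then h.choose else 1

/-- local gamma function -/
noncomputable def gam (x : ℚ_[p]) : ZMod 8 := gam0 p x.valuation (upart p x)

variable {p}

theorem pne : (p : ℚ_[p]) ≠ 0 := by exact_mod_cast hp.out.ne_zero

theorem gam_eq (v : ℤ) (u : ℤ_[p]) (hu : IsUnit u) :
    gam p ((p : ℚ_[p]) ^ v * u) = gam0 p v u := by
  have hu1 : ‖(u : ℚ_[p])‖ = 1 := by
    have := PadicInt.isUnit_iff.1 hu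
    simpa using this
  have hu0 : (u : ℚ_[p]) ≠ 0 := by intro h; rw [h] at hu1; simp at hu1
  have hv : ((p : ℚ_[p]) ^ v * u).valuation = v := by
    have hz : (u : ℚ_[p]).valuation = 0 := by
      have := Padic.norm_eq_zpow_neg_valuation hu0
      rw [hu1] at this
      have h3 : (1 : ℝ) < p := by exact_mod_cast hp.out.one_lt
      have h4 := (zpow_eq_one_iff_right₀ (by positivity : (0:ℝ) ≤ p) h3.ne').1 this.symm
      omega
    rw [Padic.valuation_mul (zpow_ne_zero _ pne) hu0, Padic.valuation_zpow, hz]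
    simp
  have hup : upart p ((p : ℚ_[p]) ^ v * u) = u := by
    have h5 : (u : ℚ_[p]) = (p : ℚ_[p]) ^ v * u * (p : ℚ_[p]) ^ (-v) := by
      rw [mul_right_comm, ← zpow_add₀ pne]; simp
    have h6 : ∃ y : ℤ_[p], (y : ℚ_[p]) = ((p : ℚ_[p]) ^ v * u) *
        (p : ℚ_[p]) ^ (-((p : ℚ_[p]) ^ v * u).valuation) := ⟨u, by rw [hv]; exact h5⟩
    unfold upart
    rw [dif_pos h6]
    have h7 := h6.choose_spec
    have h8 : (p : ℚ_[p]) ^ v * u * (p : ℚ_[p]) ^ (-((p : ℚ_[p]) ^ v * u).valuation) = u := by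
      rw [hv, ← h5]
    have h9 := h7.trans h8
    exact Subtype.ext h9
  unfold gam
  rw [hv, hup]

theorem exists_dec (x : ℚ_[p]) (hx : x ≠ 0) :
    ∃ (v : ℤ) (u : ℤ_[p]), IsUnit u ∧ x = (p : ℚ_[p]) ^ v * u := by
  have hn : ‖x * (p : ℚ_[p]) ^ (-x.valuation)‖ = 1 := by
    rw [norm_mul, Padic.norm_eq_zpow_neg_valuation hx, Padic.norm_p_zpow, ← zpow_add₀]
    · simp
    · exact_mod_cast hp.out.ne_zero
  refine ⟨x.valuation, ⟨_, hn.le⟩, PadicInt.isUnit_iff.2 hn, ?_⟩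
  simp only
  rw [mul_comm x, ← mul_assoc, ← zpow_add₀ pne]; simp

theorem exists_decI (x : ℤ_[p]) (hx : x ≠ 0) :
    ∃ (j : ℕ) (u : ℤ_[p]), IsUnit u ∧ x = (p : ℤ_[p]) ^ j * u :=
  ⟨x.valuation, PadicInt.unitCoeff hx, Units.isUnit _, by
    conv_lhs => rw [PadicInt.unitCoeff_spec hx]
    ring⟩

theorem gam0_parity (v w : ℤ) (u : ℤ_[p]) (h : Even v ↔ Even w) : gam0 p v u = gam0 p w u := by
  unfold gam0; simp only [h]

theorem toZMod_p : PadicInt.toZMod (p : ℤ_[p]) = 0 := by simp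

theorem toZMod_ne {u : ℤ_[p]} (hu : IsUnit u) : PadicInt.toZMod u ≠ 0 :=
  (hu.map (PadicInt.toZMod (p := p))).ne_zero

/-- the core relation -/
def CoreRel (p : ℕ) [Fact p.Prime] : Prop := ∀ (α : ℤ) (t j : ℕ) (u w s : ℤ_[p]), IsUnit u → IsUnit w → IsUnit s →
    u + (p : ℤ_[p]) ^ t * w = (p : ℤ_[p]) ^ j * s →
    gam0 p α u + gam0 p (α + t) w = gam0 p (α + j) s + gam0 p (α + t + j) (u * w * s)

theorem core_odd (h2 : p ≠ 2) : CoreRel p := by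
  intro α t j u w s hu hw hs h
  have hm := congrArg (PadicInt.toZMod (p := p)) h
  simp only [map_add, map_mul, map_pow, toZMod_p] at hm
  have hc : ringChar (ZMod p) ≠ 2 := by rw [ZMod.ringChar_zmod_n]; exact h2
  unfold gam0
  simp only [if_neg h2, map_mul]
  have hU := toZMod_ne hu
  have hW := toZMod_ne hw
  have hS := toZMod_ne hs
  generalize PadicInt.toZMod u = U at *
  generalize PadicInt.toZMod w = W at *
  generalize PadicInt.toZMod s = S at *
  have cU := quadraticChar_dichotomy hU
  have cW := quadraticChar_dichotomy hW
  have cS := quadraticChar_dichotomy hS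
  have hj : t ≠ 0 → j = 0 ∧ S = U := by
    intro ht
    rw [zero_pow ht] at hm
    by_cases hj : j = 0
    · subst hj; simp at hm; exact ⟨rfl, hm.symm⟩
    · rw [zero_pow hj] at hm; simp at hm; exact absurd hm hU
  have hneg : t = 0 → j ≠ 0 → quadraticChar (ZMod p) U * quadraticChar (ZMod p) W =
      quadraticChar (ZMod p) (-1) := by
    intro ht hj'
    subst ht
    rw [zero_pow hj'] at hm
    have : W = -1 * U := by linear_combination hm
    rw [this, map_mul]
    rcases cU with h | h <;> rw [h] <;> ring
  have hm1 : quadraticChar (ZMod p) (-1) = ZMod.χ₄ p := by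
    rw [quadraticChar_neg_one hc, ZMod.card]
  have hm2 : (p % 8 = 1 ∨ p % 8 = 5) ∧ ZMod.χ₄ p = 1 ∨ (p % 8 = 3 ∨ p % 8 = 7) ∧ ZMod.χ₄ p = -1 := by
    have : p % 2 = 1 := hp.out.eq_two_or_odd.resolve_left h2
    have h4 : p % 4 = 1 ∨ p % 4 = 3 := by omega
    rcases h4 with h4 | h4
    · left; exact ⟨by omega, ZMod.χ₄_nat_one_mod_four h4⟩
    · right; exact ⟨by omega, ZMod.χ₄_nat_three_mod_four h4⟩
  rw [hm1] at hneg
  have hj2 : t ≠ 0 → j = 0 ∧ quadraticChar (ZMod p) S = quadraticChar (ZMod p) U := by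
    intro ht; obtain ⟨h1, h3⟩ := hj ht; exact ⟨h1, by rw [h3]⟩
  generalize quadraticChar (ZMod p) U = a at *
  generalize quadraticChar (ZMod p) W = b at *
  have hP : ∀ x : ℤ, x % 8 = 0 → ((x : ℤ) : ZMod 8) = 0 := by
    intro x hx; exact (ZMod.intCast_zmod_eq_zero_iff_dvd x 8).2 (by push_cast; omega)
  rw [← sub_eq_zero]
  by_cases ht : t = 0
  · subst ht
    by_cases hj0 : j = 0
    · subst hj0
      by_cases ha : Even α
      · simp [ha]
      · simp only [Nat.cast_zero, add_zero, ha, if_false]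
        generalize quadraticChar (ZMod p) S = c at *
        rw [← Int.cast_add, ← Int.cast_add, ← Int.cast_sub]
        apply hP
        rcases cU with rfl | rfl <;> rcases cW with rfl | rfl <;> rcases cS with rfl | rfl <;> omega
    · have hab := hneg rfl hj0
      generalize quadraticChar (ZMod p) S = c at *
      generalize ZMod.χ₄ p = d at *
      simp only [Nat.cast_zero, add_zero]
      by_cases ha : Even α <;> by_cases hb : Even (α + (j : ℤ)) <;> simp only [ha, hb, if_true, if_false]
      · simp
      all_goals
        simp only [← Int.cast_add, ← Int.cast_sub, ← Int.cast_zero (R := ZMod 8)]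
        apply hP
        rcases cU with rfl | rfl <;> rcases cW with rfl | rfl <;> rcases cS with rfl | rfl <;> omega
  · obtain ⟨rfl, e⟩ := hj2 ht
    simp only [Nat.cast_zero, add_zero]
    have : a * b * a = b := by rcases cU with rfl | rfl <;> ring
    rw [e, this]; ring

/-- residue mod 8 -/
noncomputable def res8 : ℤ_[2] →+* ZMod 8 :=
  (ZMod.castHom (show 8 ∣ 2 ^ 3 by norm_num) (ZMod 8)).comp (PadicInt.toZModPow 3)

/-- antisquare sign -/
def om8 (x : ZMod 8) : ZMod 8 := if x = 1 ∨ x = 7 then 0 else 4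

theorem gam0_two (v : ℤ) (u : ℤ_[2]) :
    gam0 2 v u = res8 u + if Even v then 0 else om8 (res8 u) := by
  have h : (ZMod.cast (PadicInt.toZModPow 3 u) : ZMod 8) = res8 u := rfl
  unfold gam0
  rw [if_pos rfl, h]
  unfold om8
  rfl

theorem core_two : CoreRel 2 := by
  intro α t j u w s hu hw hs h
  have hm := congrArg res8 h
  simp only [gam0_two, map_add, map_mul, map_pow] at hm ⊢
  have hU := hu.map res8
  have hW := hw.map res8
  have hS := hs.map res8
  have h2 : res8 ((2 : ℕ) : ℤ_[2]) = 2 := by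
    rw [map_natCast]; rfl
  rw [h2] at hm
  generalize res8 u = U at *
  generalize res8 w = W at *
  generalize res8 s = S at *
  have hunit : ∀ x : ZMod 8, IsUnit x → x = 1 ∨ x = 3 ∨ x = 5 ∨ x = 7 := by
    intro x hx
    obtain ⟨y, hy⟩ := isUnit_iff_exists_inv.1 hx
    revert x y; decide
  have pw : ∀ k : ℕ, 3 ≤ k → (2 : ZMod 8) ^ k = 0 := by
    intro k hk
    obtain ⟨l, rfl⟩ := Nat.exists_eq_add_of_le hk
    rw [pow_add]; have : (2 : ZMod 8) ^ 3 = 0 := by decide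
    rw [this, zero_mul]
  have hU := hunit U hU
  have hW := hunit W hW
  have hS := hunit S hS
  have par : ∀ k : ℕ, (Even (α + k : ℤ) ↔ (Even α ↔ Even k)) := by
    intro k; rw [Int.even_add, Int.even_coe_nat]
  have par2 : Even (α + t + j : ℤ) ↔ ((Even α ↔ Even t) ↔ Even j) := by
    rw [Int.even_add, Int.even_add, Int.even_coe_nat, Int.even_coe_nat]
  simp only [par, par2]
  have key : ∀ (ea et ej : Bool) (T J U W S : ZMod 8), 
      (U = 1 ∨ U = 3 ∨ U = 5 ∨ U = 7) → (W = 1 ∨ W = 3 ∨ W = 5 ∨ W = 7) →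
      (S = 1 ∨ S = 3 ∨ S = 5 ∨ S = 7) → (et = true ∧ T = 1 ∨ et = false ∧ T = 2 ∨ et = true ∧ T = 4 ∨ T = 0) →
      (ej = true ∧ J = 1 ∨ ej = false ∧ J = 2 ∨ ej = true ∧ J = 4 ∨ J = 0) →
      U + T * W = J * S →
      (U + if ea then 0 else om8 U) + (W + if ea == et then 0 else om8 W) =
       (S + if ea == ej then 0 else om8 S) +
        (U * W * S + if (ea == et) == ej then 0 else om8 (U * W * S)) := by
    intro ea et ej T J U W S hU hW hS hT hJ
    rcases hT with ⟨rfl, rfl⟩ | ⟨rfl, rfl⟩ | ⟨rfl, rfl⟩ | rfl <;>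
    rcases hJ with ⟨rfl, rfl⟩ | ⟨rfl, rfl⟩ | ⟨rfl, rfl⟩ | rfl <;>
    rcases hU with rfl | rfl | rfl | rfl <;> rcases hW with rfl | rfl | rfl | rfl <;>
    rcases hS with rfl | rfl | rfl | rfl <;> decide +revert
  have hpw : ∀ k : ℕ, (decide (Even k) = true ∧ (2 : ZMod 8) ^ k = 1 ∨ decide (Even k) = false ∧ (2 : ZMod 8) ^ k = 2 ∨
      decide (Even k) = true ∧ (2 : ZMod 8) ^ k = 4 ∨ (2 : ZMod 8) ^ k = 0) := by
    intro k
    by_cases hk : 3 ≤ k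
    · right; right; right; exact pw k hk
    · interval_cases k <;> decide
  have := key (decide (Even α)) (decide (Even t)) (decide (Even j)) _ _ U W S hU hW hS (hpw t) (hpw j) hm
  clear key hpw hm pw hunit h
  by_cases h1 : Even α <;> by_cases h3 : Even t <;> by_cases h4 : Even j <;>
    simp only [h1, h3, h4, decide_true, decide_false, if_true, if_false, beq_self_eq_true,
      iff_self, true_iff, false_iff, iff_false, not_true, not_false_iff, iff_true,
      Bool.false_beq, Bool.true_beq, Bool.not_true, Bool.not_false,
      Bool.false_eq_true] at this ⊢ <;> exact this

theorem core_all : CoreRel p := by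
  by_cases h : p = 2
  · subst h; exact core_two
  · exact core_odd h

theorem gam0_sq (v : ℤ) (u w : ℤ_[p]) (hu : IsUnit u) (hw : IsUnit w) : gam0 p v (u * w ^ 2) = gam0 p v u := by
  by_cases h : p = 2
  · subst h
    rw [gam0_two, gam0_two, map_mul, map_pow]
    have : ∀ x : ZMod 8, IsUnit x → x ^ 2 = 1 := by
      intro x hx
      obtain ⟨y, hy⟩ := isUnit_iff_exists_inv.1 hx
      revert x y; decide
    rw [this _ (hw.map res8), mul_one]
  · unfold gam0
    simp only [if_neg h, map_mul, map_pow]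
    rw [← map_pow, quadraticChar_sq_one' (toZMod_ne hw), mul_one]

theorem gam_GW (p : ℕ) [hp : Fact p.Prime] : GWFun (gam p) := by
  constructor
  · intro a s ha hs
    obtain ⟨α, u, hu, rfl⟩ := exists_dec a ha
    obtain ⟨σ, w, hw, rfl⟩ := exists_dec s hs
    have : (p : ℚ_[p]) ^ α * u * ((p : ℚ_[p]) ^ σ * w) ^ 2 =
        (p : ℚ_[p]) ^ (α + 2 * σ) * ((u * w ^ 2 : ℤ_[p]) : ℚ_[p]) := by
      rw [zpow_add₀ pne, two_mul, zpow_add₀ pne]; push_cast; ring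
    rw [this, gam_eq _ _ (hu.mul (hw.pow 2)), gam_eq _ _ hu, gam0_sq _ _ _ hu hw]
    exact gam0_parity _ _ _ (by rw [Int.even_add]; simp)
  · have main : ∀ (α : ℤ) (t : ℕ) (u w : ℤ_[p]), IsUnit u → IsUnit w →
        (p : ℚ_[p]) ^ α * u + (p : ℚ_[p]) ^ (α + t) * w ≠ 0 →
        gam p ((p : ℚ_[p]) ^ α * u) + gam p ((p : ℚ_[p]) ^ (α + t) * w) =
        gam p ((p : ℚ_[p]) ^ α * u + (p : ℚ_[p]) ^ (α + t) * w) +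
        gam p ((p : ℚ_[p]) ^ α * u * ((p : ℚ_[p]) ^ (α + t) * w) *
          ((p : ℚ_[p]) ^ α * u + (p : ℚ_[p]) ^ (α + t) * w)) := by
      intro α t u w hu hw hne
      have e1 : (p : ℚ_[p]) ^ α * u + (p : ℚ_[p]) ^ (α + t) * w =
          (p : ℚ_[p]) ^ α * ((u + (p : ℤ_[p]) ^ t * w : ℤ_[p]) : ℚ_[p]) := by
        rw [zpow_add₀ pne]; push_cast; rw [zpow_natCast]; ring
      have hne' : u + (p : ℤ_[p]) ^ t * w ≠ 0 := by
        intro h; rw [e1, h] at hne; simp at hne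
      obtain ⟨j, s, hs, hjs⟩ := exists_decI _ hne'
      have e2 : (p : ℚ_[p]) ^ α * u + (p : ℚ_[p]) ^ (α + t) * w =
          (p : ℚ_[p]) ^ (α + j) * s := by
        rw [e1, hjs, zpow_add₀ pne]; push_cast; rw [zpow_natCast]; ring
      have e3 : (p : ℚ_[p]) ^ α * u * ((p : ℚ_[p]) ^ (α + t) * w) * ((p : ℚ_[p]) ^ (α + j) * s) =
          (p : ℚ_[p]) ^ (α + (α + t) + (α + j)) * ((u * w * s : ℤ_[p]) : ℚ_[p]) := by
        rw [zpow_add₀ pne (α + (α + t)), zpow_add₀ pne α (α + t)]; push_cast; ring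
      rw [e2, e3, gam_eq _ _ hu, gam_eq _ _ hw, gam_eq _ _ hs, gam_eq _ _ ((hu.mul hw).mul hs),
        core_all α t j u w s hu hw hs hjs]
      congr 1
      apply gam0_parity
      simp only [Int.even_add]
      tauto
    intro a b ha hb hab
    obtain ⟨α, u, hu, rfl⟩ := exists_dec a ha
    obtain ⟨β, w, hw, rfl⟩ := exists_dec b hb
    rcases le_total α β with h | h
    · obtain ⟨t, rfl⟩ := Int.le.dest h
      exact main α t u w hu hw hab
    · obtain ⟨t, rfl⟩ := Int.le.dest h
      have := main β t w u hw hu (by rwa [add_comm])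
      rw [add_comm, this]
      congr 2
      · ring
      · ring
end PartB

section PartB2

/-- additive Jacobi sign with values in `{0, 4}` -/
def tJ (b : ℕ) (p : ℕ) : ZMod 8 := ((2 - 2 * jacobiSym b p : ℤ) : ZMod 8)

theorem tJ_mul (b c p : ℕ) (hb : b.Coprime p) (hc : c.Coprime p) :
    tJ (b * c) p = tJ b p + tJ c p := by
  unfold tJ
  have h1 : jacobiSym b p = 1 ∨ jacobiSym b p = -1 := jacobiSym.eq_one_or_neg_one (by simpa using hb)
  have h2 : jacobiSym c p = 1 ∨ jacobiSym c p = -1 := jacobiSym.eq_one_or_neg_one (by simpa using hc)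
  rw [Nat.cast_mul, jacobiSym.mul_left]
  rcases h1 with h1 | h1 <;> rcases h2 with h2 | h2 <;> rw [h1, h2] <;> decide

theorem tJ_prod (P : Finset ℕ) (p : ℕ) (h : ∀ r ∈ P, r.Coprime p) :
    tJ (∏ r ∈ P, r) p = ∑ r ∈ P, tJ r p := by
  induction P using Finset.induction_on with
  | empty => simp [tJ]
  | insert q P hq ih =>
    rw [Finset.prod_insert hq, Finset.sum_insert hq, tJ_mul, ih]
    · intro r hr; exact h r (Finset.mem_insert_of_mem hr)
    · exact h q (Finset.mem_insert_self _ _)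
    · exact Nat.Coprime.prod_left fun r hr => h r (Finset.mem_insert_of_mem hr)

theorem tJ_recip (p q : ℕ) (hp : Odd p) (hq : Odd q) (hpq : p.Coprime q) :
    tJ p q + tJ q p = ((p : ZMod 8) - 1) * ((q : ZMod 8) - 1) := by
  unfold tJ
  have h1 : jacobiSym p q = 1 ∨ jacobiSym p q = -1 := jacobiSym.eq_one_or_neg_one (by simpa using hpq)
  have h3 := jacobiSym.quadratic_reciprocity hp hq
  have h2 : jacobiSym q p = (-1) ^ (p / 2 * (q / 2)) * jacobiSym p q := by
    rw [h3, ← mul_assoc, ← pow_add, ← two_mul, pow_mul]; simp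
  rw [h2]
  obtain ⟨x, rfl⟩ := hp
  obtain ⟨y, rfl⟩ := hq
  have e1 : (2 * x + 1) / 2 = x := by omega
  have e2 : (2 * y + 1) / 2 = y := by omega
  rw [e1, e2]
  push_cast
  have : ((2 : ZMod 8) * x + 1 - 1) * (2 * y + 1 - 1) = 4 * ((x * y : ℕ) : ZMod 8) := by
    push_cast; ring
  rw [this]
  generalize x * y = z
  have h4 : ((2 : ZMod 8) - 2 * (jacobiSym (2 * (x : ℤ) + 1) (2 * y + 1) : ZMod 8)) +
     (2 - 2 * ((-1) ^ z * (jacobiSym (2 * (x : ℤ) + 1) (2 * y + 1) : ZMod 8))) = 4 * (z : ZMod 8) := by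
    push_cast at h1
    rcases Nat.even_or_odd z with hz | hz
    · rw [hz.neg_one_pow]
      obtain ⟨w, rfl⟩ := hz
      have : (4 : ZMod 8) * ((w + w : ℕ) : ZMod 8) = 0 := by
        push_cast; rw [← two_mul, ← mul_assoc]
        have : (4 : ZMod 8) * 2 = 0 := by decide
        rw [this, zero_mul]
      rw [this]
      rcases h1 with h1 | h1 <;> rw [h1] <;> decide
    · rw [hz.neg_one_pow]
      obtain ⟨w, rfl⟩ := hz
      have : (4 : ZMod 8) * ((2 * w + 1 : ℕ) : ZMod 8) = 4 := by
        push_cast; rw [mul_add, ← mul_assoc]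
        have : (4 : ZMod 8) * 2 = 0 := by decide
        rw [this, zero_mul]; simp
      rw [this]
      rcases h1 with h1 | h1 <;> rw [h1] <;> decide
  exact h4

theorem odd_cast8 (p : ℕ) (h1 : p.Prime) (h2 : p ≠ 2) : ∃ x : ZMod 8, (p : ZMod 8) = 2 * x + 1 := by
  obtain ⟨x, rfl⟩ := h1.odd_of_ne_two h2
  exact ⟨x, by push_cast; ring⟩

theorem odd_prod8 (P : Finset ℕ) (hP : ∀ p ∈ P, p.Prime ∧ p ≠ 2) :
    ∃ y : ZMod 8, ∏ p ∈ P, (p : ZMod 8) = 2 * y + 1 := by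
  induction P using Finset.induction_on with
  | empty => exact ⟨0, by simp⟩
  | insert r P hr ih2 =>
    obtain ⟨y, hy⟩ := ih2 fun p hp => hP p (Finset.mem_insert_of_mem hp)
    obtain ⟨z, hz⟩ := odd_cast8 r (hP r (by simp)).1 (hP r (by simp)).2
    rw [Finset.prod_insert hr, hy, hz]
    exact ⟨2 * z * y + z + y, by ring⟩

theorem sum_sub_one (P : Finset ℕ) (hP : ∀ p ∈ P, p.Prime ∧ p ≠ 2) (c : ZMod 8)
    (hc : 4 * c = 0) :
    c * (∏ p ∈ P, (p : ZMod 8) - 1) + c * ∑ p ∈ P, ((p : ZMod 8) - 1) = 0 := by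
  induction P using Finset.induction_on with
  | empty => simp
  | insert q P hq ih =>
    have hP' := fun p hp => hP p (Finset.mem_insert_of_mem hp)
    have ih := ih hP'
    have h8 : (8 : ZMod 8) = 0 := by decide
    rw [Finset.prod_insert hq, Finset.sum_insert hq]
    obtain ⟨x, hx⟩ := odd_cast8 q (hP q (Finset.mem_insert_self _ _)).1 (hP q (Finset.mem_insert_self _ _)).2
    obtain ⟨y, hy⟩ := odd_prod8 P hP'
    rw [hy] at ih
    rw [hx, hy]
    linear_combination ih + hc * (x * y + x)

theorem QR_odd (P : Finset ℕ) (hP : ∀ p ∈ P, p.Prime ∧ p ≠ 2) :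
    ∑ p ∈ P, ((1 - (p : ZMod 8)) + ∑ r ∈ P.erase p, tJ r p) + ∏ p ∈ P, (p : ZMod 8) = 1 := by
  induction P using Finset.induction_on with
  | empty => simp
  | insert q P hq ih =>
    have hP' := fun p hp => hP p (Finset.mem_insert_of_mem hp)
    have ih := ih hP'
    have hqq := hP q (Finset.mem_insert_self _ _)
    rw [Finset.sum_insert hq, Finset.prod_insert hq, Finset.erase_insert hq]
    have e1 : ∑ p ∈ P, ((1 - (p : ZMod 8)) + ∑ r ∈ (insert q P).erase p, tJ r p) =
        ∑ p ∈ P, ((1 - (p : ZMod 8)) + ∑ r ∈ P.erase p, tJ r p) + ∑ p ∈ P, tJ q p := by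
      rw [← Finset.sum_add_distrib]
      refine Finset.sum_congr rfl fun p hp => ?_
      have hne : q ≠ p := fun h => hq (h ▸ hp)
      rw [Finset.erase_insert_of_ne hne, Finset.sum_insert (fun h => hq (Finset.mem_of_mem_erase h))]
      ring
    have e2 : ∑ p ∈ P, tJ q p + ∑ p ∈ P, tJ p q = ((q : ZMod 8) - 1) * ∑ p ∈ P, ((p : ZMod 8) - 1) := by
      rw [← Finset.sum_add_distrib, Finset.mul_sum]
      refine Finset.sum_congr rfl fun p hp => ?_
      exact tJ_recip q p (hqq.1.odd_of_ne_two hqq.2) ((hP' p hp).1.odd_of_ne_two (hP' p hp).2)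
        ((Nat.coprime_primes hqq.1 (hP' p hp).1).2 fun h => hq (h ▸ hp))
    have e3 := sum_sub_one P hP' ((q : ZMod 8) - 1) (by
      obtain ⟨x, rfl⟩ := hqq.1.odd_of_ne_two hqq.2
      push_cast
      have : (8 : ZMod 8) = 0 := by decide
      linear_combination (x : ZMod 8) * this)
    rw [e1]
    linear_combination ih + e2 + e3

theorem om8_mul : ∀ a b : ZMod 8, (∃ y, a * y = 1) → (∃ y, b * y = 1) → om8 (a * b) = om8 a + om8 b := by
  decide

theorem odd_unit8 (p : ℕ) (hp : Odd p) : ∃ y : ZMod 8, (p : ZMod 8) * y = 1 := by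
  have : IsUnit (p : ZMod 8) := by
    rw [ZMod.isUnit_iff_coprime]
    have : Nat.Coprime p (2 ^ 3) := Nat.Coprime.pow_right _ (by simpa using hp)
    simpa using this
  exact isUnit_iff_exists_inv.1 this

theorem QR_two (P : Finset ℕ) (hP : ∀ p ∈ P, p.Prime ∧ p ≠ 2) :
    ∑ p ∈ P, tJ 2 p + om8 (∏ p ∈ P, (p : ZMod 8)) = 0 := by
  induction P using Finset.induction_on with
  | empty => simp; decide
  | insert q P hq ih =>
    have hP' := fun p hp => hP p (Finset.mem_insert_of_mem hp)
    have ih := ih hP'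
    have hqq := hP q (Finset.mem_insert_self _ _)
    have hqo := hqq.1.odd_of_ne_two hqq.2
    rw [Finset.sum_insert hq, Finset.prod_insert hq, om8_mul]
    · have : tJ 2 q + om8 q = 0 := by
        unfold tJ
        have h := jacobiSym.at_two hqo
        have h3 : ((2 : ℕ) : ℤ) = 2 := rfl
        rw [h3, h]
        obtain ⟨y, hy⟩ := odd_unit8 q hqo
        clear h ih
        generalize (q : ZMod 8) = Q at *
        clear * - hy
        revert Q y; decide
      linear_combination ih + this
    · exact odd_unit8 q hqo
    · rw [← Nat.cast_prod]
      apply odd_unit8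
      exact Finset.prod_induction _ Odd (fun _ _ => Odd.mul) odd_one
        fun p hp => (hP' p hp).1.odd_of_ne_two (hP' p hp).2

/-- total version on naturals -/
noncomputable def gamN (p a : ℕ) : ZMod 8 :=
  if h : p.Prime then haveI := Fact.mk h; gam p (a : ℚ_[p]) else 0

theorem gamN_eq (p a : ℕ) [hp : Fact p.Prime] : gamN p a = gam p (a : ℚ_[p]) := by
  unfold gamN; rw [dif_pos hp.out]

theorem natCast_isUnit {p : ℕ} [hp : Fact p.Prime] {a : ℕ} (h : ¬ p ∣ a) : IsUnit (a : ℤ_[p]) := by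
  rw [PadicInt.isUnit_iff]
  by_contra hn
  have h1 : ‖(a : ℤ_[p])‖ < 1 := lt_of_le_of_ne (PadicInt.norm_le_one _) hn
  have := (PadicInt.norm_int_lt_one_iff_dvd (p := p) (a : ℤ)).1 (by simpa using h1)
  exact h (by exact_mod_cast this)

theorem gamN_unit (p a : ℕ) (hp : p.Prime) (h2 : p ≠ 2) (h : ¬ p ∣ a) : gamN p a = 0 := by
  haveI := Fact.mk hp
  have := gam_eq (p := p) 0 (a : ℤ_[p]) (natCast_isUnit h)
  rw [gamN_eq]
  simp at this
  rw [this]; unfold gam0; simp [h2]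

theorem gamN_p (p b : ℕ) (hp : p.Prime) (h2 : p ≠ 2) (h : ¬ p ∣ b) :
    gamN p (p * b) = (1 - (p : ZMod 8)) + tJ b p := by
  haveI := Fact.mk hp
  have := gam_eq (p := p) 1 (b : ℤ_[p]) (natCast_isUnit h)
  rw [gamN_eq]
  simp at this
  push_cast
  rw [this]; unfold gam0 tJ
  simp only [if_neg h2, Int.not_even_one, if_false, ← jacobiSym.legendreSym.to_jacobiSym, legendreSym, map_natCast]
  push_cast
  ring

theorem gamN_two (a : ℕ) (h : Odd a) : gamN 2 a = a := by
  have := gam_eq (p := 2) 0 (a : ℤ_[2]) (natCast_isUnit (by rw [← even_iff_two_dvd]; simpa using h))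
  rw [gamN_eq]
  simp at this
  rw [this, gam0_two]; simp

theorem gamN_two' (a : ℕ) (h : Odd a) : gamN 2 (2 * a) = a + om8 a := by
  have := gam_eq (p := 2) 1 (a : ℤ_[2]) (natCast_isUnit (by rw [← even_iff_two_dvd]; simpa using h))
  rw [gamN_eq]
  simp at this
  push_cast
  rw [this, gam0_two]; simp

theorem gamN_sq (p a s : ℕ) (ha : a ≠ 0) (hs : s ≠ 0) : gamN p (a * s ^ 2) = gamN p a := by
  unfold gamN
  split_ifs with h
  · haveI := Fact.mk h
    push_cast
    exact (gam_GW p).1 _ _ (by exact_mod_cast ha) (by exact_mod_cast hs)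
  · rfl

theorem gamN_sum_sqfree (P T : Finset ℕ) (hP : ∀ p ∈ P, p.Prime ∧ p ≠ 2) (hT : ∀ p ∈ T, p.Prime)
    (h2T : 2 ∈ T) (hPT : P ⊆ T) (ε : ℕ) (hε : ε = 0 ∨ ε = 1) :
    ∑ p ∈ T, gamN p (2 ^ ε * ∏ r ∈ P, r) = 1 := by
  have h2P : 2 ∉ P := fun h => (hP 2 h).2 rfl
  have hodd : Odd (∏ r ∈ P, r) := Finset.prod_induction _ Odd (fun _ _ => Odd.mul) odd_one
        fun p hp => (hP p hp).1.odd_of_ne_two (hP p hp).2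
  have hndvd : ∀ p, p.Prime → p ≠ 2 → ∀ P' ⊆ P, p ∉ P' → ¬ p ∣ 2 ^ ε * ∏ r ∈ P', r := by
    intro p hp hp2 P' hP' hpP h
    rcases (hp.dvd_mul).1 h with h | h
    · exact hp2 ((Nat.prime_dvd_prime_iff_eq hp Nat.prime_two).1 (hp.dvd_of_dvd_pow h))
    · obtain ⟨r, hr, hpr⟩ := (Prime.dvd_finsetProd_iff hp.prime _).1 h
      rw [(Nat.prime_dvd_prime_iff_eq hp (hP r (hP' hr)).1).1 hpr] at hpP
      exact hpP hr
  have hsub : insert 2 P ⊆ T := Finset.insert_subset h2T hPT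
  rw [← Finset.sum_subset hsub, Finset.sum_insert h2P]
  · have e1 : ∀ p ∈ P, gamN p (2 ^ ε * ∏ r ∈ P, r) =
        (1 - (p : ZMod 8)) + ∑ r ∈ P.erase p, tJ r p + ε * tJ 2 p := by
      intro p hp
      have : 2 ^ ε * ∏ r ∈ P, r = p * (2 ^ ε * ∏ r ∈ P.erase p, r) := by
        rw [← Finset.mul_prod_erase _ _ hp]; ring
      have hpc : ∀ r ∈ P.erase p, r.Coprime p := by
        intro r hr
        simp at hr
        exact (Nat.coprime_primes (hP r hr.2).1 (hP p hp).1).2 hr.1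
      have h2c : Nat.Coprime 2 p := (Nat.coprime_primes Nat.prime_two (hP p hp).1).2 (hP p hp).2.symm
      rw [this, gamN_p p _ (hP p hp).1 (hP p hp).2
        (hndvd p (hP p hp).1 (hP p hp).2 _ (Finset.erase_subset _ _) (by simp)),
        tJ_mul _ _ _ (h2c.pow_left _) (Nat.Coprime.prod_left hpc), tJ_prod _ _ hpc]
      have : tJ (2 ^ ε) p = ε * tJ 2 p := by
        rcases hε with rfl | rfl <;> simp [tJ]
      rw [this]; ring
    rw [Finset.sum_congr rfl e1, Finset.sum_add_distrib, ← Finset.mul_sum]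
    have q1 := QR_odd P hP
    have q2 := QR_two P hP
    rcases hε with rfl | rfl
    · rw [pow_zero, one_mul, gamN_two _ hodd]
      push_cast
      linear_combination q1
    · rw [pow_one, gamN_two' _ hodd]
      push_cast
      linear_combination q1 + q2
  · intro p hp hpn
    simp at hpn
    exact gamN_unit p _ (hT p hp) hpn.1 (hndvd p (hT p hp) hpn.1 P subset_rfl hpn.2)

theorem gamN_sum (T : Finset ℕ) (hT : ∀ p ∈ T, p.Prime) (h2T : 2 ∈ T) (a : ℕ) (ha : a ≠ 0)
    (hpf : a.primeFactors ⊆ T) : ∑ p ∈ T, gamN p a = 1 := by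
  obtain ⟨b, s, hbs, hb⟩ := Nat.sq_mul_squarefree a
  have hs : s ≠ 0 := by rintro rfl; simp at hbs; exact ha hbs.symm
  have hb0 : b ≠ 0 := hb.ne_zero
  have e : ∀ p ∈ T, gamN p a = gamN p b := by
    intro p _
    rw [← hbs, mul_comm, gamN_sq _ _ _ hb0 hs]
  rw [Finset.sum_congr rfl e]
  have hbT : b.primeFactors ⊆ T := (Nat.primeFactors_mono (Dvd.intro_left _ hbs) ha).trans hpf
  have hprod := Nat.prod_primeFactors_of_squarefree hb
  by_cases h2 : 2 ∈ b.primeFactors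
  · have := gamN_sum_sqfree (b.primeFactors.erase 2) T (by
      intro p hp; simp only [Finset.mem_erase] at hp
      exact ⟨Nat.prime_of_mem_primeFactors hp.2, hp.1⟩) hT h2T
      ((Finset.erase_subset _ _).trans hbT) 1 (Or.inr rfl)
    rwa [pow_one, Finset.mul_prod_erase b.primeFactors (fun x => x) h2, hprod] at this
  · have := gamN_sum_sqfree b.primeFactors T (by
      intro p hp
      exact ⟨Nat.prime_of_mem_primeFactors hp, by rintro rfl; exact h2 hp⟩) hT h2T hbT 0 (Or.inl rfl)
    rwa [pow_zero, one_mul, hprod] at this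
end PartB2
section PartM
variable {R : Type*} [CommRing R]
variable {ι κ μ ν : Type*} [Fintype ι] [DecidableEq ι] [Fintype κ] [DecidableEq κ]
  [Fintype μ] [DecidableEq μ] [Fintype ν] [DecidableEq ν]

/-- `K` represents `A`. -/
def Rp (K : Matrix ι ι R) (A : Matrix κ κ R) : Prop := ∃ T : Matrix ι κ R, Tᵀ * K * T = A

/-- `A` and `B` are isometric. -/
def Iso (A : Matrix ι ι R) (B : Matrix κ κ R) : Prop :=
  ∃ (U : Matrix ι κ R) (V : Matrix κ ι R), U * V = 1 ∧ V * U = 1 ∧ Uᵀ * A * U = B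

/-- orthogonal sum -/
def dsum (A : Matrix ι ι R) (B : Matrix κ κ R) : Matrix (ι ⊕ κ) (ι ⊕ κ) R := fromBlocks A 0 0 B

/-- the unary form -/
def un (a : R) : Matrix Unit Unit R := fun _ _ => a

theorem Iso.rp {A : Matrix ι ι R} {B : Matrix κ κ R} (h : Iso A B) : Rp A B := by
  obtain ⟨U, V, _, _, h⟩ := h; exact ⟨U, h⟩

theorem Iso.refl (A : Matrix ι ι R) : Iso A A := ⟨1, 1, by simp, by simp, by simp⟩

theorem Iso.symm {A : Matrix ι ι R} {B : Matrix κ κ R} (h : Iso A B) : Iso B A := by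
  obtain ⟨U, V, h1, h2, rfl⟩ := h
  refine ⟨V, U, h2, h1, ?_⟩
  have : Vᵀ * (Uᵀ * A * U) * V = (U * V)ᵀ * A * (U * V) := by
    rw [transpose_mul]; simp only [Matrix.mul_assoc]
  rw [this, h1]; simp

theorem Iso.trans {A : Matrix ι ι R} {B : Matrix κ κ R} {C : Matrix μ μ R} (h : Iso A B)
    (h' : Iso B C) : Iso A C := by
  obtain ⟨U, V, h1, h2, rfl⟩ := h
  obtain ⟨U', V', h1', h2', rfl⟩ := h'
  refine ⟨U * U', V' * V, ?_, ?_, ?_⟩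
  · rw [Matrix.mul_assoc, ← Matrix.mul_assoc U', h1', Matrix.one_mul, h1]
  · rw [Matrix.mul_assoc, ← Matrix.mul_assoc V, h2, Matrix.one_mul, h2']
  · rw [transpose_mul]; simp only [Matrix.mul_assoc]

theorem Rp.trans {A : Matrix ι ι R} {B : Matrix κ κ R} {C : Matrix μ μ R} (h : Rp A B)
    (h' : Rp B C) : Rp A C := by
  obtain ⟨U, rfl⟩ := h
  obtain ⟨U', rfl⟩ := h'
  exact ⟨U * U', by rw [transpose_mul]; simp only [Matrix.mul_assoc]⟩

theorem iso_reindex (e : ι ≃ κ) (A : Matrix κ κ R) : Iso A (A.submatrix e e) := by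
  refine ⟨(1 : Matrix κ κ R).submatrix id e, (1 : Matrix κ κ R).submatrix e id, ?_, ?_, ?_⟩
  · rw [submatrix_mul_equiv _ _ _ e]; simp
  · rw [← submatrix_mul _ _ _ _ _ Function.bijective_id]; simp
  · rw [transpose_submatrix]
    conv_lhs => rw [show A = A.submatrix id id by simp]
    rw [← submatrix_mul _ _ _ _ _ Function.bijective_id, ← submatrix_mul _ _ _ _ _ Function.bijective_id]
    simp

theorem iso_of_unit {A B U : Matrix ι ι R} (hU : IsUnit U.det) (h : Uᵀ * A * U = B) : Iso A B :=
  ⟨U, U⁻¹, mul_nonsing_inv _ hU, nonsing_inv_mul _ hU, h⟩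

theorem Iso.unit {A B : Matrix ι ι R} (h : Iso A B) : ∃ U : Matrix ι ι R, IsUnit U.det ∧ Uᵀ * A * U = B := by
  obtain ⟨U, V, h1, h2, h3⟩ := h
  refine ⟨U, ?_, h3⟩
  have := congrArg det h1
  rw [det_mul, det_one] at this
  exact IsUnit.of_mul_eq_one _ this

theorem Iso.det {A B : Matrix ι ι R} (h : Iso A B) : ∃ r, IsUnit r ∧ B.det = A.det * r ^ 2 := by
  obtain ⟨U, hU, rfl⟩ := h.unit
  exact ⟨U.det, hU, by simp [det_mul]; ring⟩

theorem Iso.dsum {A : Matrix ι ι R} {B : Matrix κ κ R} {C : Matrix μ μ R} {D : Matrix ν ν R}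
    (h : Iso A B) (h' : Iso C D) : Iso (dsum A C) (dsum B D) := by
  obtain ⟨U, V, h1, h2, rfl⟩ := h
  obtain ⟨U', V', h1', h2', rfl⟩ := h'
  refine ⟨fromBlocks U 0 0 U', fromBlocks V 0 0 V', ?_, ?_, ?_⟩
  · simp [fromBlocks_multiply, h1, h1']
  · simp [fromBlocks_multiply, h2, h2']
  · simp [_root_.dsum, fromBlocks_multiply, fromBlocks_transpose]

theorem Rp.dsum {A : Matrix ι ι R} {B : Matrix κ κ R} {C : Matrix μ μ R} {D : Matrix ν ν R}
    (h : Rp A B) (h' : Rp C D) : Rp (dsum A C) (dsum B D) := by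
  obtain ⟨U, rfl⟩ := h
  obtain ⟨U', rfl⟩ := h'
  refine ⟨fromBlocks U 0 0 U', ?_⟩
  · simp [_root_.dsum, fromBlocks_multiply, fromBlocks_transpose]

theorem Rp.refl (A : Matrix ι ι R) : Rp A A := (Iso.refl A).rp

theorem dsum_left (A : Matrix ι ι R) (B : Matrix κ κ R) : Rp (dsum A B) A := by
  refine ⟨fromRows 1 0, ?_⟩
  ext i j
  simp [_root_.dsum, transpose_fromRows, fromCols_mul_fromBlocks, fromCols_mul_fromRows]

theorem dsum_comm' (A : Matrix ι ι R) (B : Matrix κ κ R) : Iso (dsum A B) (dsum B A) := by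
  have := iso_reindex (Equiv.sumComm κ ι) (dsum A B)
  convert this using 1
  ext (i | i) (j | j) <;> rfl

theorem dsum_assoc (A : Matrix ι ι R) (B : Matrix κ κ R) (C : Matrix μ μ R) :
    Iso (dsum (dsum A B) C) (dsum A (dsum B C)) := by
  have := iso_reindex (Equiv.sumAssoc ι κ μ).symm (dsum (dsum A B) C)
  convert this using 1
  ext (i | i | i) (j | j | j) <;> rfl

theorem det_dsum (A : Matrix ι ι R) (B : Matrix κ κ R) : (dsum A B).det = A.det * B.det :=
  det_fromBlocks_zero₂₁ A 0 B

theorem det_un (a : R) : (un a).det = a := by simp [un]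

theorem dsum_symm {A : Matrix ι ι R} {B : Matrix κ κ R} (hA : A.IsSymm) (hB : B.IsSymm) :
    (dsum A B).IsSymm := by
  unfold dsum; exact hA.fromBlocks (by simp) hB

theorem un_symm (a : R) : (un a).IsSymm := by ext; rfl

theorem Rp.symm {A : Matrix ι ι R} {B : Matrix κ κ R} (h : Rp A B) (hA : A.IsSymm) : B.IsSymm := by
  obtain ⟨U, rfl⟩ := h
  unfold Matrix.IsSymm at *
  rw [transpose_mul, transpose_mul, transpose_transpose, hA, Matrix.mul_assoc]

theorem Rp_un {K : Matrix ι ι R} (x : ι → R) (a : R) (h : x ⬝ᵥ K *ᵥ x = a) : Rp K (un a) := by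
  refine ⟨Matrix.of fun i _ => x i, ?_⟩
  ext i j
  rw [Matrix.mul_assoc]
  simp only [un, mul_apply, transpose_apply, of_apply]
  exact h

theorem un_sq (a s : R) : Rp (un a) (un (a * s ^ 2)) := ⟨un s, by ext; simp [un, mul_apply]; ring⟩

theorem un_iso (a s : R) (hs : IsUnit s) : Iso (un a) (un (a * s ^ 2)) := by
  refine iso_of_unit (U := un s) (by simpa [det_un]) (by ext; simp [un, mul_apply]; ring)

/-- splitting off a unit vector -/
theorem split_lemma {M : Matrix ι ι R} (hM : M.IsSymm) (x : ι → R) (i : ι) (hi : IsUnit (x i))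
    (u : R) (hu : IsUnit u) (h : x ⬝ᵥ M *ᵥ x = u) :
    ∃ M' : Matrix {j // j ≠ i} {j // j ≠ i} R, M'.IsSymm ∧ Iso M (dsum (un u) M') := by
  classical
  set U : Matrix ι ι R := (1 : Matrix ι ι R).updateCol i x with hU
  have hdet : U.det = x i := by
    have := cramer_apply (1 : Matrix ι ι R) x i
    rw [← this]; simp
  have h1 : Iso M (Uᵀ * M * U) := iso_of_unit (by rw [hdet]; exact hi) rfl
  set M1 := Uᵀ * M * U with hM1
  have hs1 : M1.IsSymm := h1.rp.symm hM
  have hent : M1 i i = u := by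
    rw [← h, hM1, Matrix.mul_assoc, mul_apply]
    simp [hU, dotProduct, mul_apply, mulVec, Matrix.updateCol_apply]
  let e : Unit ⊕ {j // j ≠ i} ≃ ι :=
    { toFun := Sum.elim (fun _ => i) (fun j => j.1)
      invFun := fun j => if hj : j = i then Sum.inl () else Sum.inr ⟨j, hj⟩
      left_inv := by rintro (j | ⟨j, hj⟩) <;> simp [*]
      right_inv := by intro j; by_cases hj : j = i <;> simp [hj] }
  have h2 := iso_reindex e M1
  set M2 := M1.submatrix e e with hM2
  have hs2 : M2.IsSymm := h2.rp.symm hs1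
  set A := M2.toBlocks₁₁ with hA
  set B := M2.toBlocks₁₂ with hB
  set D := M2.toBlocks₂₂ with hD
  have hA' : A = un u := by ext; simp [hA, hM2, toBlocks₁₁, e, hent, un]
  have hC : M2.toBlocks₂₁ = Bᵀ := by
    ext a b; simp only [toBlocks₂₁, hB, toBlocks₁₂, transpose_apply, of_apply]; rw [hs2.apply]
  have hDs : Dᵀ = D := by
    ext a b; simp only [hD, toBlocks₂₂, transpose_apply, of_apply]; rw [hs2.apply]
  have hAs : Aᵀ = A := by rw [hA']; exact un_symm u
  have hfb : M2 = fromBlocks A B Bᵀ D := by rw [← hC]; exact (fromBlocks_toBlocks M2).symm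
  have hAi : Invertible A := by
    apply invertibleOfIsUnitDet; rw [hA', det_un]; exact hu
  have hAis : (⅟A)ᵀ = ⅟A := by
    rw [invOf_eq_nonsing_inv, transpose_nonsing_inv, hAs]
  have hf : M2 = _ := hfb.trans (fromBlocks_eq_of_invertible₁₁ A B Bᵀ D)
  refine ⟨D - Bᵀ * ⅟A * B, ?_, ?_⟩
  · unfold Matrix.IsSymm
    rw [transpose_sub, transpose_mul, transpose_mul, transpose_transpose, hAis, hDs, Matrix.mul_assoc]
  · refine h1.trans (h2.trans (Iso.symm ?_))
    refine ⟨fromBlocks 1 (⅟A * B) 0 1, fromBlocks 1 (-(⅟A * B)) 0 1, ?_, ?_, ?_⟩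
    · simp [fromBlocks_multiply]
    · simp [fromBlocks_multiply]
    · rw [hf, dsum, ← hA', fromBlocks_transpose, transpose_mul, hAis]
      simp

end PartM
section PartC
variable {p : ℕ} [hp : Fact p.Prime]

theorem hensel_sq (t a : ℤ_[p]) (h : ‖a ^ 2 - t‖ < ‖2 * a‖ ^ 2) : ∃ s : ℤ_[p], t = s ^ 2 := by
  obtain ⟨z, hz, _⟩ := hensels_lemma (p := p) (F := (Polynomial.X ^ 2 - Polynomial.C t : Polynomial ℤ_[p]))
    (a := a) (by simpa [one_add_one_eq_two] using h)
  refine ⟨z, ?_⟩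
  simp at hz
  linear_combination -hz

theorem norm_two_odd (h2 : p ≠ 2) : ‖(2 : ℤ_[p])‖ = 1 := by
  have : IsUnit ((2 : ℕ) : ℤ_[p]) := natCast_isUnit (by
    intro h; exact h2 ((Nat.prime_dvd_prime_iff_eq hp.out Nat.prime_two).1 h))
  exact PadicInt.isUnit_iff.1 (by simpa using this)

theorem toZMod_eq_zero_iff (x : ℤ_[p]) : PadicInt.toZMod x = 0 ↔ ¬ IsUnit x := by
  rw [← RingHom.mem_ker, PadicInt.ker_toZMod, IsLocalRing.mem_maximalIdeal, mem_nonunits_iff]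

theorem sq_odd (h2 : p ≠ 2) (t : ℤ_[p]) (ht : IsUnit t) (hs : IsSquare (PadicInt.toZMod t)) :
    ∃ s : ℤ_[p], IsUnit s ∧ t = s ^ 2 := by
  obtain ⟨c, hc⟩ := hs
  obtain ⟨a, rfl⟩ := ZMod.ringHom_surjective (PadicInt.toZMod (p := p)) c
  have hau : IsUnit a := by
    by_contra h
    rw [← toZMod_eq_zero_iff] at h
    rw [h, mul_zero, toZMod_eq_zero_iff] at hc
    exact hc ht
  have h3 : ‖a ^ 2 - t‖ < 1 := by
    have : ¬ IsUnit (a ^ 2 - t) := by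
      rw [← toZMod_eq_zero_iff, map_sub, map_pow, hc]; ring
    exact PadicInt.not_isUnit_iff.1 this
  obtain ⟨s, hs⟩ := hensel_sq t a (by rw [norm_mul, norm_two_odd h2, PadicInt.isUnit_iff.1 hau]; simpa using h3)
  refine ⟨s, ?_, hs⟩
  rw [hs] at ht
  exact isUnit_pow_iff (by norm_num) |>.1 ht

theorem sq_cube (t : ℤ_[p]) (ht : (p : ℤ_[p]) ^ 3 ∣ t - 1) : ∃ s : ℤ_[p], IsUnit s ∧ t = s ^ 2 := by
  have h1 : ‖t - 1‖ ≤ (p : ℝ) ^ (-(3 : ℤ)) := by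
    have := (PadicInt.norm_le_pow_iff_mem_span_pow (t - 1) 3).2 (Ideal.mem_span_singleton.2 ht)
    simpa using this
  have hp1 : (1 : ℝ) < p := by exact_mod_cast hp.out.one_lt
  have h1' : ‖(1 : ℤ_[p]) ^ 2 - t‖ ≤ (p : ℝ) ^ (-(3 : ℤ)) := by
    rw [← norm_neg]; convert h1 using 1; congr 1; ring
  have hu : IsUnit t := by
    have : ‖t - 1‖ < 1 := lt_of_le_of_lt h1 (by
      rw [_root_.zpow_neg]; apply inv_lt_one_of_one_lt₀; exact one_lt_pow₀ hp1 (by norm_num))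
    rw [PadicInt.isUnit_iff]
    by_contra h
    have h' : ‖t‖ < 1 := lt_of_le_of_ne (PadicInt.norm_le_one t) h
    have : ‖(1 : ℤ_[p])‖ < 1 := by
      have e : (1 : ℤ_[p]) = t + -(t - 1) := by ring
      rw [e]
      refine lt_of_le_of_lt (PadicInt.nonarchimedean _ _) (max_lt h' (by rwa [norm_neg]))
    simp at this
  obtain ⟨s, hs⟩ : ∃ s : ℤ_[p], t = s ^ 2 := by
    apply hensel_sq t 1
    refine lt_of_le_of_lt h1' ?_
    rw [mul_one]
    by_cases h2 : p = 2
    · subst h2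
      have : ‖(2 : ℤ_[2])‖ = (2 : ℝ)⁻¹ := by
        have := PadicInt.norm_p (p := 2)
        simpa using this
      rw [this, _root_.zpow_neg]; norm_num
    · rw [norm_two_odd h2, _root_.zpow_neg]
      rw [one_pow]; apply inv_lt_one_of_one_lt₀; exact one_lt_pow₀ hp1 (by norm_num)
  refine ⟨s, ?_, hs⟩
  rw [hs] at hu
  exact isUnit_pow_iff (by norm_num) |>.1 hu

theorem binary_one (h2 : p ≠ 2) (u v : ℤ_[p]) (hu : IsUnit u) (hv : IsUnit v) :
    ∃ x y : ℤ_[p], u * x ^ 2 + v * y ^ 2 = 1 := by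
  set U := PadicInt.toZMod u with hU
  set V := PadicInt.toZMod v with hV
  have hU0 : U ≠ 0 := by rw [hU, Ne, toZMod_eq_zero_iff]; simpa using hu
  have hV0 : V ≠ 0 := by rw [hV, Ne, toZMod_eq_zero_iff]; simpa using hv
  have hcard : Fintype.card (ZMod p) % 2 = 1 := by
    rw [ZMod.card]; exact Nat.odd_iff.1 (hp.out.odd_of_ne_two h2)
  obtain ⟨a, b, hab⟩ := FiniteField.exists_root_sum_quadratic
    (f := (Polynomial.C U * Polynomial.X ^ 2 - 1 : Polynomial (ZMod p)))
    (g := (Polynomial.C V * Polynomial.X ^ 2 : Polynomial (ZMod p)))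
    (by compute_degree!) (by compute_degree!) hcard
  simp at hab
  obtain ⟨x, rfl⟩ := ZMod.ringHom_surjective (PadicInt.toZMod (p := p)) a
  obtain ⟨y, rfl⟩ := ZMod.ringHom_surjective (PadicInt.toZMod (p := p)) b
  have key : ∀ (u v x y : ℤ_[p]), IsUnit u → IsUnit x → PadicInt.toZMod (u * x ^ 2 + v * y ^ 2 - 1) = 0 →
      ∃ x y : ℤ_[p], u * x ^ 2 + v * y ^ 2 = 1 := by
    intro u v x y hu hx h
    obtain ⟨w, hw⟩ := isUnit_iff_exists_inv.1 hu
    have e1 : PadicInt.toZMod ((1 - v * y ^ 2) * w) = PadicInt.toZMod x * PadicInt.toZMod x := by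
      have e : (1 - v * y ^ 2) * w = x * x + (-w) * (u * x ^ 2 + v * y ^ 2 - 1) := by
        linear_combination x ^ 2 * hw
      rw [e, map_add, map_mul, map_mul, h, mul_zero, add_zero]
    obtain ⟨s, hs, hs2⟩ := sq_odd h2 ((1 - v * y ^ 2) * w) (by
      by_contra hc
      rw [← toZMod_eq_zero_iff, e1] at hc
      have := mul_self_eq_zero.1 hc
      rw [toZMod_eq_zero_iff] at this
      exact this hx) ⟨_, e1⟩
    refine ⟨s, y, ?_⟩
    rw [← hs2]
    linear_combination (1 - v * y ^ 2) * hw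
  by_cases hx : IsUnit x
  · apply key u v x y hu hx
    simp only [map_sub, map_add, map_mul, map_pow, map_one]
    linear_combination hab
  · have hy : IsUnit y := by
      by_contra hy
      rw [← toZMod_eq_zero_iff] at hx hy
      rw [hx, hy] at hab
      simp at hab
    obtain ⟨a, b, h⟩ := key v u y x hv hy (by
      simp only [map_sub, map_add, map_mul, map_pow, map_one]
      linear_combination hab)
    exact ⟨b, a, by linear_combination h⟩

variable {ι κ : Type} [Fintype ι] [DecidableEq ι] [Fintype κ] [DecidableEq κ]

theorem unit_coord {M : Matrix ι ι ℤ_[p]} {x : ι → ℤ_[p]} (h : IsUnit (x ⬝ᵥ M *ᵥ x)) : ∃ i, IsUnit (x i) := by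
  by_contra hc
  push Not at hc
  have : x ⬝ᵥ M *ᵥ x ∈ IsLocalRing.maximalIdeal ℤ_[p] :=
    Ideal.sum_mem _ fun i _ => Ideal.mul_mem_right _ _ ((IsLocalRing.mem_maximalIdeal _).2 (hc i))
  exact (IsLocalRing.mem_maximalIdeal _).1 this h

theorem repr_unit (h2 : p ≠ 2) {M : Matrix ι ι ℤ_[p]} (hM : M.IsSymm) (hd : IsUnit M.det) (i : ι) :
    ∃ x : ι → ℤ_[p], IsUnit (x ⬝ᵥ M *ᵥ x) := by
  by_contra hc
  push Not at hc
  set I := IsLocalRing.maximalIdeal ℤ_[p] with hI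
  have hc' : ∀ x : ι → ℤ_[p], x ⬝ᵥ M *ᵥ x ∈ I := fun x => (IsLocalRing.mem_maximalIdeal _).2 (hc x)
  have hent : ∀ j, M i j ∈ I := by
    intro j
    have a1 := hc' (Pi.single i 1)
    have a2 := hc' (Pi.single j 1)
    have a3 := hc' (Pi.single i 1 + Pi.single j 1)
    simp only [mulVec_add, dotProduct_add, add_dotProduct] at a3
    simp at a1 a2 a3
    rw [hM.apply i j] at a3
    have a4 : 2 * M i j ∈ I := by
      have := I.sub_mem (I.sub_mem a3 a1) a2
      convert this using 1; ring
    have hu2 : IsUnit (2 : ℤ_[p]) := PadicInt.isUnit_iff.2 (norm_two_odd h2)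
    exact (Ideal.unit_mul_mem_iff_mem _ hu2).1 a4
  have : M.det ∈ I := by
    rw [det_eq_sum_mul_adjugate_row M i]
    exact Ideal.sum_mem _ fun j _ => Ideal.mul_mem_right _ _ (hent j)
  exact (IsLocalRing.mem_maximalIdeal _).1 this hd

theorem isoD {R : Type*} [CommRing R] {A : Matrix ι ι R} {B : Matrix κ κ R} (h : Iso A B)
    (hc : Fintype.card ι = Fintype.card κ) : ∃ r, IsUnit r ∧ B.det = A.det * r ^ 2 := by
  obtain ⟨e⟩ := Fintype.card_eq.1 hc
  obtain ⟨r, hr, h'⟩ := (h.trans (iso_reindex e B)).det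
  exact ⟨r, hr, by rw [← h', det_submatrix_equiv_self]⟩

theorem isoU {R : Type*} [CommRing R] {A : Matrix ι ι R} {u : R} {B : Matrix κ κ R} (h : Iso A (dsum (un u) B))
    (hc : Fintype.card ι = Fintype.card (Unit ⊕ κ)) (hA : IsUnit A.det) : IsUnit B.det := by
  obtain ⟨r, hr, h'⟩ := isoD h hc
  rw [det_dsum] at h'
  have : IsUnit ((un u).det * B.det) := by rw [h']; exact hA.mul (hr.pow 2)
  exact isUnit_of_mul_isUnit_right this

theorem split_one (h2 : p ≠ 2) {M : Matrix ι ι ℤ_[p]} (hM : M.IsSymm) (hd : IsUnit M.det)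
    (hcard : 2 ≤ Fintype.card ι) :
    ∃ (i : ι) (M' : Matrix {j // j ≠ i} {j // j ≠ i} ℤ_[p]), M'.IsSymm ∧ Iso M (dsum (un 1) M') := by
  obtain ⟨i0⟩ : Nonempty ι := Fintype.card_pos_iff.1 (by omega)
  obtain ⟨x, hx⟩ := repr_unit h2 hM hd i0
  obtain ⟨i, hi⟩ := unit_coord hx
  obtain ⟨M1, hM1, hiso⟩ := split_lemma hM x i hi _ hx rfl
  set u := x ⬝ᵥ M *ᵥ x
  have hc1 : Fintype.card {j // j ≠ i} = Fintype.card ι - 1 := by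
    simp [Fintype.card_subtype_compl]
  obtain ⟨i1⟩ : Nonempty {j // j ≠ i} := Fintype.card_pos_iff.1 (by omega)
  have hd1 : IsUnit M1.det := (isoU hiso (by simp [hc1]; omega) hd)
  obtain ⟨y, hy⟩ := repr_unit h2 hM1 hd1 i1
  obtain ⟨a, b, hab⟩ := binary_one h2 u _ hx hy
  have hr : Rp M (un (1 : ℤ_[p])) := by
    refine hiso.rp.trans (((Rp.refl (un u)).dsum (Rp_un y _ rfl)).trans ?_)
    apply Rp_un (Sum.elim (fun _ => a) (fun _ => b))
    rw [← hab]
    simp [dotProduct, mulVec, dsum, un]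
    ring
  obtain ⟨T, hT⟩ := hr
  set z : ι → ℤ_[p] := fun i => T i () with hz
  have hz1 : z ⬝ᵥ M *ᵥ z = 1 := by
    have := congrFun (congrFun hT ()) ()
    rw [Matrix.mul_assoc] at this
    simp only [un, mul_apply, transpose_apply] at this
    exact this
  obtain ⟨k, hk⟩ := unit_coord (M := M) (x := z) (by rw [hz1]; exact isUnit_one)
  exact ⟨k, split_lemma hM z k hk 1 isUnit_one hz1⟩

/-- classification of unimodular forms over `ℤ_p`, `p` odd -/
theorem unimod_iso (h2 : p ≠ 2) : ∀ (n : ℕ) (ι κ : Type) [Fintype ι] [DecidableEq ι] [Fintype κ]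
    [DecidableEq κ] (M : Matrix ι ι ℤ_[p]) (N : Matrix κ κ ℤ_[p]), Fintype.card ι = n →
    Fintype.card κ = n → M.IsSymm → N.IsSymm → IsUnit M.det → ∀ r, IsUnit r →
    N.det = M.det * r ^ 2 → Iso M N := by
  intro n
  induction n with
  | zero =>
    intro ι κ _ _ _ _ M N hι hκ _ _ _ _ _ _
    have := Fintype.card_eq_zero_iff.1 hι
    have := Fintype.card_eq_zero_iff.1 hκ
    exact ⟨0, 0, by ext i; exact isEmptyElim i, by ext i; exact isEmptyElim i, by ext i; exact isEmptyElim i⟩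
  | succ n ih =>
    intro ι κ _ _ _ _ M N hι hκ hM hN hd r hr hdet
    rcases Nat.eq_zero_or_pos n with rfl | hn
    · obtain ⟨e⟩ := Fintype.card_eq.1 (hι.trans Fintype.card_unit.symm)
      obtain ⟨f⟩ := Fintype.card_eq.1 (hκ.trans Fintype.card_unit.symm)
      have h1 := iso_reindex e.symm M
      have h2 := iso_reindex f.symm N
      refine h1.trans (Iso.trans ?_ h2.symm)
      have hu : ∀ A : Matrix Unit Unit ℤ_[p], A = un A.det := by intro A; ext; simp [un]
      rw [hu (M.submatrix _ _), hu (N.submatrix _ _), det_submatrix_equiv_self, det_submatrix_equiv_self, hdet]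
      exact un_iso _ _ hr
    · have hdN : IsUnit N.det := by rw [hdet]; exact hd.mul (hr.pow 2)
      obtain ⟨i, M', hM', hMi⟩ := split_one h2 hM hd (by omega)
      obtain ⟨j, N', hN', hNi⟩ := split_one h2 hN hdN (by omega)
      have c1 : Fintype.card {k // k ≠ i} = n := by simp [Fintype.card_subtype_compl, hι]
      have c2 : Fintype.card {k // k ≠ j} = n := by simp [Fintype.card_subtype_compl, hκ]
      obtain ⟨s, hs, hs'⟩ := isoD hMi (by simp [c1, hι]; omega)
      obtain ⟨t, ht, ht'⟩ := isoD hNi (by simp [c2, hκ]; omega)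
      rw [det_dsum, det_un, one_mul] at hs' ht'
      obtain ⟨w, hw⟩ := isUnit_iff_exists_inv.1 hs
      refine hMi.trans (Iso.trans ((Iso.refl _).dsum (ih _ _ M' N' c1 c2 hM' hN' ?_ (r * t * w) ?_ ?_)) hNi.symm)
      · rw [hs']; exact hd.mul (hs.pow 2)
      · exact (hr.mul ht).mul (IsUnit.of_mul_eq_one _ (by rw [mul_comm]; exact hw))
      · rw [ht', hs', hdet]
        linear_combination -(s * w + 1) * M.det * r ^ 2 * t ^ 2 * hw
end PartC
section PartD
variable {R : Type*} [CommRing R] [IsDomain R]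
variable {ι κ : Type*} [Fintype ι] [DecidableEq ι] [Fintype κ] [DecidableEq κ]

theorem quad_zero (h2 : (2 : R) ≠ 0) {Q : Matrix ι ι R} (hQ : Q.IsSymm) (h : ∀ v, v ⬝ᵥ Q *ᵥ v = 0) :
    Q = 0 := by
  ext i j
  have a1 := h (Pi.single i 1)
  have a2 := h (Pi.single j 1)
  have a3 := h (Pi.single i 1 + Pi.single j 1)
  simp only [mulVec_add, dotProduct_add, add_dotProduct] at a3
  simp at a1 a2 a3
  rw [hQ.apply i j, a1, a2] at a3
  have : 2 * Q i j = 0 := by linear_combination a3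
  simpa [h2] using this

theorem rp_fromCols {K : Matrix ι ι R} (hK : K.IsSymm) {A : Matrix κ κ R} {T : Matrix ι κ R} (hT : Tᵀ * K * T = A)
    (w : ι → R) (hw : (Tᵀ * K) *ᵥ w = 0) :
    (fromCols T (Matrix.of fun i (_ : Unit) => w i))ᵀ * K * (fromCols T (Matrix.of fun i (_ : Unit) => w i)) =
      dsum A (un (w ⬝ᵥ K *ᵥ w)) := by
  rw [transpose_fromCols, fromRows_mul, fromRows_mul_fromCols, hT]
  unfold dsum
  have e1 : Tᵀ * K * (Matrix.of fun i (_ : Unit) => w i) = 0 := by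
    ext i j; exact congrFun hw i
  have e2 : (Matrix.of fun i (_ : Unit) => w i)ᵀ * K * T = 0 := by
    rw [← transpose_inj, transpose_mul, transpose_mul, transpose_transpose, hK, ← Matrix.mul_assoc, e1]; simp
  rw [e1, e2]
  congr 1
  ext i j
  rw [Matrix.mul_assoc]
  simp only [un, mul_apply, transpose_apply, of_apply]
  rfl

theorem local_vec (h2 : (2 : R) ≠ 0) {K : Matrix ι ι R} (hK : K.IsSymm) (hKd : K.det ≠ 0) {A : Matrix κ κ R}
    (hA : A.det ≠ 0) (hr : Rp K A) (hc : Fintype.card κ < Fintype.card ι) :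
    ∃ α : R, α ≠ 0 ∧ Rp K (dsum A (un α)) := by
  obtain ⟨T, hT⟩ := hr
  have hAs : A.IsSymm := Rp.symm ⟨T, hT⟩ hK
  set E : Matrix ι ι R := A.det • (1 : Matrix ι ι R) - T * A.adjugate * Tᵀ * K with hE
  have h1 : Tᵀ * K * E = 0 := by
    rw [hE, Matrix.mul_sub]
    have : Tᵀ * K * (T * A.adjugate * Tᵀ * K) = (Tᵀ * K * T) * A.adjugate * (Tᵀ * K) := by
      simp only [Matrix.mul_assoc]
    rw [this, hT, mul_adjugate]
    simp
  by_contra hcon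
  push Not at hcon
  have h3 : ∀ v, v ⬝ᵥ (Eᵀ * K * E) *ᵥ v = 0 := by
    intro v
    by_contra hv
    refine hcon (E *ᵥ v ⬝ᵥ K *ᵥ (E *ᵥ v)) ?_ ⟨_, rp_fromCols hK hT (E *ᵥ v) ?_⟩
    · convert hv using 1
      rw [← mulVec_mulVec, ← mulVec_mulVec, dotProduct_mulVec v, vecMul_transpose]
    · rw [mulVec_mulVec, h1]; simp
  have h4 : Eᵀ * K * E = 0 := quad_zero h2 (Rp.symm ⟨E, rfl⟩ hK) h3
  have h5 : Eᵀ * K * E = A.det • (K * E) := by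
    have : Eᵀ = A.det • (1 : Matrix ι ι R) - K * T * A.adjugateᵀ * Tᵀ := by
      rw [hE, transpose_sub, transpose_smul]
      simp only [transpose_mul, transpose_transpose, transpose_one, hK.eq, Matrix.mul_assoc]
    rw [this, Matrix.sub_mul, Matrix.sub_mul]
    have e : K * T * A.adjugateᵀ * Tᵀ * K * E = K * T * A.adjugateᵀ * (Tᵀ * K * E) := by
      simp only [Matrix.mul_assoc]
    rw [e, h1]; simp
  have h6 : E = 0 := by
    rw [h4] at h5
    have : K.adjugate * (A.det • (K * E)) = (A.det * K.det) • E := by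
      rw [Matrix.mul_smul, ← Matrix.mul_assoc, adjugate_mul]; simp [smul_smul]
    rw [← h5, Matrix.mul_zero] at this
    exact (smul_eq_zero.1 this.symm).resolve_left (mul_ne_zero hA hKd)
  have h7 : A.det • (1 : Matrix ι ι R) = T * (A.adjugate * Tᵀ * K) := by
    rw [h6] at hE
    rw [eq_comm, sub_eq_zero] at hE
    rw [hE]; simp only [Matrix.mul_assoc]
  set X := A.adjugate * Tᵀ * K
  have hinj : Function.Injective X.mulVecLin := by
    rw [← LinearMap.ker_eq_bot, LinearMap.ker_eq_bot']
    intro v hv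
    have := congrArg (fun Z => Z *ᵥ v) h7
    simp only [← mulVec_mulVec, smul_mulVec, one_mulVec] at this
    rw [mulVecLin_apply] at hv
    rw [hv, mulVec_zero] at this
    exact (smul_eq_zero.1 this).resolve_left hA
  have := card_le_of_injective R X.mulVecLin hinj
  omega

end PartD

section PartDir

theorem dirichlet_lemma (S : Finset ℕ) (hS : ∀ p ∈ S, p.Prime)
    (α : (p : ℕ) → [Fact p.Prime] → ℤ_[p]) (hα : ∀ p [Fact p.Prime], p ∈ S → α p ≠ 0) (N : ℕ) :
    ∃ M q : ℕ, 0 < M ∧ q.Prime ∧ N < q ∧ q ∉ S ∧ M.primeFactors ⊆ S ∧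
      ∀ p [Fact p.Prime], p ∈ S → ∃ s : ℤ_[p], ((M * q : ℕ) : ℤ_[p]) = α p * s ^ 2 := by
  classical
  let v : ℕ → ℕ := fun p => if h : p.Prime then (haveI := Fact.mk h; (α p).valuation) else 0
  let M := ∏ p ∈ S, p ^ v p
  let Mp : ℕ → ℕ := fun p => ∏ r ∈ S.erase p, r ^ v r
  have hMp : ∀ p ∈ S, M = p ^ v p * Mp p := fun p hp => (Finset.mul_prod_erase S _ hp).symm
  have hMpu : ∀ p [Fact p.Prime], p ∈ S → IsUnit (Mp p : ℤ_[p]) := by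
    intro p hp hpS
    apply natCast_isUnit
    intro h
    obtain ⟨r, hr, hd⟩ := (Prime.dvd_finsetProd_iff hp.out.prime _).1 h
    have := hp.out.dvd_of_dvd_pow hd
    have := (Nat.prime_dvd_prime_iff_eq hp.out (hS r (Finset.mem_of_mem_erase hr))).1 this
    exact Finset.ne_of_mem_erase hr this.symm
  have hM0 : 0 < M := Finset.prod_pos fun p hp => pow_pos (hS p hp).pos _
  have hMS : M.primeFactors ⊆ S := by
    intro p hp
    have h1 := Nat.prime_of_mem_primeFactors hp
    obtain ⟨r, hr, hd⟩ := (Prime.dvd_finsetProd_iff h1.prime _).1 (Nat.dvd_of_mem_primeFactors hp)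
    have := (Nat.prime_dvd_prime_iff_eq h1 (hS r hr)).1 (h1.dvd_of_dvd_pow hd)
    exact this ▸ hr
  -- residues
  have hres : ∀ p, p ∈ S → ∃ r : ℕ, ∀ [Fact p.Prime], ∃ u : ℤ_[p], IsUnit u ∧ α p = p ^ v p * u ∧
      (p : ℤ_[p]) ^ 3 ∣ u - r * Mp p := by
    intro p hpS
    haveI : Fact p.Prime := ⟨hS p hpS⟩
    obtain ⟨w, hw⟩ := isUnit_iff_exists_inv.1 (hMpu p hpS)
    have h0 := hα p hpS
    let u := (PadicInt.unitCoeff h0 : ℤ_[p])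
    refine ⟨(u * w).appr 3, u, Units.isUnit _, ?_, ?_⟩
    · have := PadicInt.unitCoeff_spec h0
      rw [mul_comm] at this
      have hv : v p = (α p).valuation := by simp only [v]; rw [dif_pos (hS p hpS)]
      rw [hv]; exact this
    · have := Ideal.mem_span_singleton.1 (PadicInt.appr_spec 3 (u * w))
      have h2 := Dvd.dvd.mul_right this (Mp p : ℤ_[p])
      convert h2 using 1
      linear_combination -u * hw
  choose! r hr using hres
  obtain ⟨k, hk⟩ := Nat.chineseRemainderOfFinset r (fun p => p ^ 3) S
    (fun p hp => (pow_pos (hS p hp).pos 3).ne') (by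
      intro p hp q hq hpq
      exact Nat.Coprime.pow _ _ ((Nat.coprime_primes (hS p hp) (hS q hq)).2 hpq))
  -- congruence transfer
  have htr : ∀ x : ℕ, ∀ p [Fact p.Prime], p ∈ S → x ≡ r p [MOD p ^ 3] → 
      ∃ u : ℤ_[p], IsUnit u ∧ α p = p ^ v p * u ∧ (p : ℤ_[p]) ^ 3 ∣ u - x * Mp p := by
    intro x p _ hpS hx
    obtain ⟨u, hu, h1, h2⟩ := hr p hpS
    refine ⟨u, hu, h1, ?_⟩
    have h3 : (p : ℤ_[p]) ^ 3 ∣ (r p : ℤ_[p]) - x := by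
      have h4 := (Nat.modEq_iff_dvd.1 hx)
      have h5 := map_dvd (Int.castRingHom ℤ_[p]) h4
      simpa using h5
    have := dvd_add h2 (Dvd.dvd.mul_right h3 (Mp p : ℤ_[p]))
    convert this using 1; ring
  have hnd : ∀ x : ℕ, ∀ p ∈ S, x ≡ r p [MOD p ^ 3] → ¬ p ∣ x := by
    intro x p hpS hx hd
    haveI : Fact p.Prime := ⟨hS p hpS⟩
    obtain ⟨u, hu, h1, h2⟩ := htr x p hpS hx
    have h3 : (p : ℤ_[p]) ∣ u - x * Mp p := (dvd_pow_self _ (by norm_num)).trans h2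
    have h4 : (p : ℤ_[p]) ∣ x * Mp p := Dvd.dvd.mul_right (by exact_mod_cast Nat.cast_dvd_cast hd) _
    have h5 : (p : ℤ_[p]) ∣ u := by
      have := dvd_add h3 h4
      simpa using this
    exact PadicInt.prime_p.not_isUnit (isUnit_of_dvd_unit h5 hu)
  obtain ⟨q, hqN, hq, hqk⟩ := Nat.forall_exists_prime_gt_and_modEq N (q := ∏ p ∈ S, p ^ 3) (a := k)
    (Finset.prod_ne_zero_iff.2 fun p hp => (pow_pos (hS p hp).pos 3).ne') (by
      apply Nat.Coprime.prod_right
      intro p hp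
      apply Nat.Coprime.pow_right
      exact ((Nat.Prime.coprime_iff_not_dvd (hS p hp)).2 (hnd k p hp (hk p hp))).symm)
  have hq' : ∀ p ∈ S, q ≡ r p [MOD p ^ 3] := fun p hp =>
    (hqk.of_dvd (Finset.dvd_prod_of_mem (fun p => p ^ 3) hp)).trans (hk p hp)
  refine ⟨M, q, hM0, hq, hqN, fun h => hnd q q h (hq' q h) dvd_rfl, hMS, ?_⟩
  intro p _ hpS
  obtain ⟨u, hu, h1, h2⟩ := htr q p hpS (hq' p hpS)
  obtain ⟨w, hw⟩ := isUnit_iff_exists_inv.1 hu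
  obtain ⟨s, _, hs⟩ := sq_cube ((q : ℤ_[p]) * (Mp p : ℤ_[p]) * w) (by
    have := Dvd.dvd.mul_right h2 (-w)
    convert this using 1
    linear_combination hw)
  refine ⟨s, ?_⟩
  rw [h1, hMp p hpS, ← hs]
  push_cast
  linear_combination -(p : ℤ_[p]) ^ v p * Mp p * q * hw

end PartDir
section PartG
variable {ι κ : Type} [Fintype ι] [DecidableEq ι] [Fintype κ] [DecidableEq κ]

/-- positive definite form on an arbitrary index type -/
def PD (A : Matrix ι ι ℤ) : Prop := A.IsSymm ∧ ∀ x : ι → ℤ, x ≠ 0 → 0 < x ⬝ᵥ A *ᵥ x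

/-- base change to `ℤ_p` -/
noncomputable def bc (p : ℕ) [Fact p.Prime] {ι κ : Type} (A : Matrix ι κ ℤ) : Matrix ι κ ℤ_[p] := A.map (Int.cast : ℤ → ℤ_[p])

theorem bc_eq (p : ℕ) [Fact p.Prime] {ι κ : Type} (A : Matrix ι κ ℤ) :
    bc p A = A.map (Int.castRingHom ℤ_[p]) := rfl

theorem bc_mul (p : ℕ) [Fact p.Prime] {α β : Type} (A : Matrix α ι ℤ) (B : Matrix ι β ℤ) :
    bc p (A * B) = bc p A * bc p B := by
  simp only [bc_eq]; exact Matrix.map_mul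

theorem bc_transpose (p : ℕ) [Fact p.Prime] {α β : Type} (A : Matrix α β ℤ) :
    bc p Aᵀ = (bc p A)ᵀ := rfl

theorem bc_smul (p : ℕ) [Fact p.Prime] {α β : Type} (c : ℤ) (A : Matrix α β ℤ) :
    bc p (c • A) = (c : ℤ_[p]) • bc p A := by
  ext i j; simp [bc]

theorem bc_one (p : ℕ) [Fact p.Prime] : bc p (1 : Matrix ι ι ℤ) = 1 := by
  rw [bc_eq]; simp

theorem bc_det (p : ℕ) [Fact p.Prime] (A : Matrix ι ι ℤ) : (bc p A).det = (A.det : ℤ_[p]) := by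
  rw [bc_eq]
  exact ((Int.castRingHom ℤ_[p]).map_det A).symm

theorem bc_inj (p : ℕ) [Fact p.Prime] {α β : Type} {A B : Matrix α β ℤ} (h : bc p A = bc p B) : A = B := by
  ext i j
  have := congrFun (congrFun h i) j
  simpa [bc] using this

theorem bc_symm (p : ℕ) [Fact p.Prime] {A : Matrix ι ι ℤ} (h : A.IsSymm) : (bc p A).IsSymm := by
  unfold Matrix.IsSymm; rw [← bc_transpose, h]

theorem Rp.bc {p : ℕ} [Fact p.Prime] {A : Matrix ι ι ℤ} {B : Matrix κ κ ℤ} (h : Rp A B) : Rp (bc p A) (bc p B) := by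
  obtain ⟨T, rfl⟩ := h
  exact ⟨_root_.bc p T, by rw [bc_mul, bc_mul, bc_transpose]⟩

theorem PD.det_ne {A : Matrix ι ι ℤ} (h : PD A) : A.det ≠ 0 := by
  intro h0
  obtain ⟨v, hv, h1⟩ := exists_mulVec_eq_zero_iff.2 h0
  have := h.2 v hv
  rw [h1] at this
  simp at this

theorem smul_cancel {R : Type*} [CommRing R] [IsDomain R] {α β : Type} {c : R} (hc : c ≠ 0) {A B : Matrix α β R}
    (h : c • A = c • B) : A = B := by
  ext i j
  have := congrFun (congrFun h i) j
  simpa [hc] using this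

theorem comm_inv {R : Type*} [CommRing R] [IsDomain R] {c : R} (hc : c ≠ 0) {G H : Matrix ι ι R}
    (hGH : G * H = c • 1) : G.det ≠ 0 ∧ H * G = c • 1 := by
  have hdet : G.det ≠ 0 := by
    intro h
    have := congrArg det hGH
    rw [det_mul, h, zero_mul, det_smul, det_one, mul_one] at this
    exact pow_ne_zero _ hc this.symm
  refine ⟨hdet, ?_⟩
  have h1 : G.adjugate * (G * H) * G = G.det • (H * G) := by
    rw [← Matrix.mul_assoc, adjugate_mul]; simp
  apply smul_cancel hdet
  rw [← h1, hGH]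
  simp [adjugate_mul, smul_smul, mul_comm]

theorem conj_smul_one {R : Type*} [CommRing R] (c : R) (A : Matrix ι ι R) :
    (c • (1 : Matrix ι ι R))ᵀ * A * (c • (1 : Matrix ι ι R)) = (c * c) • A := by
  simp [smul_smul]

theorem single_prime (p : ℕ) [hp : Fact p.Prime] {A : Matrix ι ι ℤ} (hA : PD A) (K : Matrix ι ι ℤ_[p])
    (hr : Rp K (bc p A)) :
    ∃ L : Matrix ι ι ℤ, PD L ∧ Rp L A ∧ Iso (bc p L) K ∧
      ∀ r [Fact r.Prime], r ≠ p → Iso (bc r L) (bc r A) := by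
  classical
  obtain ⟨R, hR⟩ := hr
  have hdR : R.det ≠ 0 := by
    intro h
    have := congrArg det hR
    rw [det_mul, h, mul_zero, bc_det] at this
    exact hA.det_ne (by exact_mod_cast this.symm)
  obtain ⟨N, R', hRR'⟩ : ∃ (N : ℕ) (R' : Matrix ι ι ℤ_[p]), R * R' = (p : ℤ_[p]) ^ N • 1 := by
    refine ⟨R.det.valuation, (↑(PadicInt.unitCoeff hdR)⁻¹ : ℤ_[p]) • R.adjugate, ?_⟩
    rw [Matrix.mul_smul, mul_adjugate, smul_smul]
    congr 1
    nth_rewrite 2 [PadicInt.unitCoeff_spec hdR]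
    rw [← mul_assoc, Units.inv_mul, one_mul]
  have hpN : ((p : ℤ_[p]) ^ N) ≠ 0 := pow_ne_zero _ (by exact_mod_cast hp.out.ne_zero)
  have hpNZ : ((p : ℤ) ^ N) ≠ 0 := pow_ne_zero _ (by exact_mod_cast hp.out.ne_zero)
  let cv : (ι → ℤ) → ι → ℤ_[p] := fun y i => (y i : ℤ_[p])
  let Γ : Submodule ℤ (ι → ℤ) :=
    { carrier := {y | ∀ i, (p : ℤ_[p]) ^ N ∣ (R *ᵥ cv y) i}
      add_mem' := by
        intro a b ha hb i
        have : cv (a + b) = cv a + cv b := by ext i; simp [cv]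
        rw [this, mulVec_add]
        exact dvd_add (ha i) (hb i)
      zero_mem' := by
        intro i
        have : cv 0 = 0 := by ext i; simp [cv]
        rw [this]; simp
      smul_mem' := by
        intro c a ha i
        have : cv (c • a) = (c : ℤ_[p]) • cv a := by ext i; simp [cv]
        rw [this, mulVec_smul]
        exact Dvd.dvd.mul_left (ha i) _ }
  have hΓ : ∀ y : ι → ℤ, ((p : ℤ) ^ N) • y ∈ Γ := by
    intro y i
    have : cv (((p : ℤ) ^ N) • y) = ((p : ℤ_[p]) ^ N) • cv y := by ext i; simp [cv]
    rw [this, mulVec_smul]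
    exact Dvd.intro _ rfl
  have hrank : Module.finrank ℤ Γ = Fintype.card ι := by
    apply le_antisymm
    · have := Submodule.finrank_le Γ
      simpa using this
    · have := LinearMap.finrank_le_finrank_of_injective
        (f := LinearMap.codRestrict Γ (((p : ℤ) ^ N) • (LinearMap.id : (ι → ℤ) →ₗ[ℤ] (ι → ℤ))) hΓ) (by
          intro x y hxy
          have := congrArg Subtype.val hxy
          funext i
          have h2 := congrFun this i
          change (p : ℤ) ^ N * x i = (p : ℤ) ^ N * y i at h2
          exact mul_left_cancel₀ hpNZ h2)
      simpa using this
  let b0 := Module.finBasisOfFinrankEq ℤ Γ hrank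
  let b := b0.reindex (Fintype.equivFin ι).symm
  let G : Matrix ι ι ℤ := fun i j => (b j).1 i
  have hG : ∀ y (hy : y ∈ Γ), G *ᵥ (fun k => b.repr ⟨y, hy⟩ k) = y := by
    intro y hy
    have := congrArg Subtype.val (b.sum_repr ⟨y, hy⟩)
    refine Eq.trans ?_ this
    ext i
    simp only [mulVec, dotProduct, G, Submodule.coe_sum, Finset.sum_apply, Submodule.coe_smul, Pi.smul_apply, smul_eq_mul]
    simp [mul_comm]
  let H : Matrix ι ι ℤ := fun k j => b.repr ⟨_, hΓ (Pi.single j 1)⟩ k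
  have hGH : G * H = ((p : ℤ) ^ N) • 1 := by
    ext i j
    have := congrFun (hG _ (hΓ (Pi.single j 1))) i
    rw [mul_apply]
    simp only [mulVec, dotProduct] at this
    rw [this]
    simp [Matrix.one_apply, Pi.single_apply]
  have hHG : H * G = ((p : ℤ) ^ N) • 1 := by
    exact (comm_inv hpNZ hGH).2
  have hU : ∃ U : Matrix ι ι ℤ_[p], R * bc p G = (p : ℤ_[p]) ^ N • U := by
    have : ∀ i j, ∃ u, (R * bc p G) i j = (p : ℤ_[p]) ^ N * u := by
      intro i j
      obtain ⟨u, hu⟩ := (b j).2 i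
      exact ⟨u, by rw [← hu]; rfl⟩
    choose U hU using this
    exact ⟨Matrix.of U, by ext i j; rw [hU]; rfl⟩
  obtain ⟨U, hU⟩ := hU
  have hL1 : bc p (Gᵀ * A * G) = ((p : ℤ_[p]) ^ (2 * N)) • (Uᵀ * K * U) := by
    rw [bc_mul, bc_mul, ← hR, bc_transpose]
    have : (bc p G)ᵀ * (Rᵀ * K * R) * bc p G = (R * bc p G)ᵀ * K * (R * bc p G) := by
      rw [transpose_mul]; simp only [Matrix.mul_assoc]
    rw [this, hU]
    simp [smul_smul, ← pow_add, two_mul]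
  obtain ⟨L, hL⟩ : ∃ L : Matrix ι ι ℤ, Gᵀ * A * G = ((p : ℤ) ^ (2 * N)) • L := by
    have : ∀ i j, (p : ℤ) ^ (2 * N) ∣ (Gᵀ * A * G) i j := by
      intro i j
      rw [← PadicInt.pow_p_dvd_int_iff]
      have := congrFun (congrFun hL1 i) j
      refine ⟨(Uᵀ * K * U) i j, ?_⟩
      exact this
    choose L hL using this
    exact ⟨Matrix.of L, by ext i j; rw [hL]; rfl⟩
  have hp2N : ((p : ℤ_[p]) ^ (2 * N)) ≠ 0 := pow_ne_zero _ (by exact_mod_cast hp.out.ne_zero)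
  have hp2NZ : ((p : ℤ) ^ (2 * N)) ≠ 0 := pow_ne_zero _ (by exact_mod_cast hp.out.ne_zero)
  have hLK : Uᵀ * K * U = bc p L := by
    apply smul_cancel hp2N
    rw [← hL1, hL, bc_smul]; push_cast; rfl
  have hUu : IsUnit U.det := by
    -- approximate R'
    let Y : Matrix ι ι ℤ := fun i j => ((R' i j).appr (N + 1) : ℤ)
    have hY : ∃ t : Matrix ι ι ℤ_[p], bc p Y = R' - (p : ℤ_[p]) ^ (N + 1) • t := by
      have : ∀ i j, ∃ t, R' i j - (R' i j).appr (N + 1) = (p : ℤ_[p]) ^ (N + 1) * t := fun i j =>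
        Ideal.mem_span_singleton.1 (PadicInt.appr_spec (N + 1) (R' i j))
      choose t ht using this
      refine ⟨Matrix.of t, ?_⟩
      ext i j
      have := ht i j
      change ((((R' i j).appr (N + 1) : ℕ) : ℤ) : ℤ_[p]) = R' i j - (p : ℤ_[p]) ^ (N + 1) * t i j
      rw [← this]
      push_cast; ring
    obtain ⟨t, ht⟩ := hY
    have hRY : R * bc p Y = (p : ℤ_[p]) ^ N • (1 - (p : ℤ_[p]) • (R * t)) := by
      rw [ht, Matrix.mul_sub, hRR', Matrix.mul_smul, smul_sub, smul_smul, pow_succ]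
    have hYΓ : ∀ j, (fun i => Y i j) ∈ Γ := by
      intro j i
      exact ⟨(1 - (p : ℤ_[p]) • (R * t)) i j, congrFun (congrFun hRY i) j⟩
    let Z : Matrix ι ι ℤ := fun k j => b.repr ⟨_, hYΓ j⟩ k
    have hGZ : G * Z = Y := by
      ext i j
      exact congrFun (hG _ (hYΓ j)) i
    have hUZ : U * bc p Z = 1 - (p : ℤ_[p]) • (R * t) := by
      apply smul_cancel hpN
      rw [← hRY, ← hGZ, bc_mul, ← Matrix.mul_assoc, hU, Matrix.smul_mul]
    have hdu : IsUnit (U * bc p Z).det := by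
      rw [hUZ]
      by_contra hc
      rw [← toZMod_eq_zero_iff, RingHom.map_det] at hc
      have : (PadicInt.toZMod (p := p)).mapMatrix (1 - (p : ℤ_[p]) • (R * t)) = 1 := by
        ext i j
        simp [Matrix.one_apply]
      rw [this, det_one] at hc
      exact one_ne_zero hc
    rw [det_mul] at hdu
    exact isUnit_of_mul_isUnit_left hdu
  have hGdet : G.det ≠ 0 := (comm_inv hpNZ hGH).1
  refine ⟨L, ⟨?_, ?_⟩, ⟨H, ?_⟩, (iso_of_unit hUu hLK).symm, ?_⟩
  · apply smul_cancel hp2NZ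
    rw [← transpose_smul, ← hL]
    exact Rp.symm (A := A) ⟨G, rfl⟩ hA.1
  · intro x hx
    have hGx : G *ᵥ x ≠ 0 := fun h => hGdet (exists_mulVec_eq_zero_iff.1 ⟨x, hx, h⟩)
    have h1 := hA.2 _ hGx
    have h2 : (G *ᵥ x) ⬝ᵥ A *ᵥ (G *ᵥ x) = ((p : ℤ) ^ (2 * N)) * (x ⬝ᵥ L *ᵥ x) := by
      have : x ⬝ᵥ (Gᵀ * A * G) *ᵥ x = (G *ᵥ x) ⬝ᵥ A *ᵥ (G *ᵥ x) := by
        rw [← mulVec_mulVec, ← mulVec_mulVec, dotProduct_mulVec x, vecMul_transpose]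
      rw [← this, hL, smul_mulVec, dotProduct_smul, smul_eq_mul]
    rw [h2] at h1
    exact pos_of_mul_pos_right h1 (by positivity)
  · apply smul_cancel hp2NZ
    have : ((p : ℤ) ^ (2 * N)) • (Hᵀ * L * H) = Hᵀ * (((p : ℤ) ^ (2 * N)) • L) * H := by
      rw [Matrix.mul_smul, Matrix.smul_mul]
    rw [this, ← hL]
    have : Hᵀ * (Gᵀ * A * G) * H = (G * H)ᵀ * A * (G * H) := by
      rw [transpose_mul]; simp only [Matrix.mul_assoc]
    rw [this, hGH, conj_smul_one, ← pow_add, two_mul]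
  · intro r hrp hne
    have hunit : IsUnit (((p ^ N : ℕ) : ℤ_[r])) := natCast_isUnit (by
      intro h
      exact hne ((Nat.prime_dvd_prime_iff_eq hrp.out hp.out).1 (hrp.out.dvd_of_dvd_pow h)))
    obtain ⟨c, hc⟩ := isUnit_iff_exists_inv.1 hunit
    push_cast at hc
    apply Iso.symm
    refine ⟨c • bc r G, bc r H, ?_, ?_, ?_⟩
    · rw [Matrix.smul_mul, ← bc_mul, hGH, bc_smul, bc_one, smul_smul]
      push_cast
      rw [mul_comm, hc, one_smul]
    · rw [Matrix.mul_smul, ← bc_mul, hHG, bc_smul, bc_one, smul_smul]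
      push_cast
      rw [mul_comm, hc, one_smul]
    · have : (c • bc r G)ᵀ * bc r A * (c • bc r G) = (c * c) • (bc r (Gᵀ * A * G)) := by
        rw [bc_mul, bc_mul, bc_transpose]; simp [smul_smul]
      rw [this, hL, bc_smul, smul_smul]
      push_cast
      have e : c * c * (p : ℤ_[r]) ^ (2 * N) = 1 := by
        rw [two_mul, pow_add]; linear_combination ((p : ℤ_[r]) ^ N * c + 1) * hc
      rw [e, one_smul]

theorem glue (S : Finset ℕ) (hS : ∀ p ∈ S, p.Prime) {A : Matrix ι ι ℤ} (hA : PD A)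
    (K : (p : ℕ) → [Fact p.Prime] → Matrix ι ι ℤ_[p]) (hK : ∀ p [Fact p.Prime], p ∈ S → Rp (K p) (bc p A)) :
    ∃ L : Matrix ι ι ℤ, PD L ∧ Rp L A ∧ ∀ p [Fact p.Prime], (p ∈ S → Iso (bc p L) (K p)) ∧
      (p ∉ S → Iso (bc p L) (bc p A)) := by
  induction S using Finset.induction_on with
  | empty => exact ⟨A, hA, Rp.refl A, fun p _ => ⟨fun h => by simp at h, fun _ => Iso.refl _⟩⟩
  | insert q S hq ih =>
    obtain ⟨L0, h0, h1, h2⟩ := ih (fun p hp => hS p (Finset.mem_insert_of_mem hp))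
      (fun p _ hp => hK p (Finset.mem_insert_of_mem hp))
    haveI : Fact q.Prime := ⟨hS q (Finset.mem_insert_self _ _)⟩
    obtain ⟨L, h3, h4, h5, h6⟩ := single_prime q h0 (K q)
      ((hK q (Finset.mem_insert_self _ _)).trans ((h2 q).2 hq).symm.rp)
    refine ⟨L, h3, h4.trans h1, ?_⟩
    intro p hp
    refine ⟨fun hpS => ?_, fun hpS => ?_⟩
    · by_cases hpq : p = q
      · subst hpq; exact h5
      · exact (h6 p hpq).trans ((h2 p).1 (Finset.mem_of_mem_insert_of_ne hpS hpq))
    · have hpq : p ≠ q := by rintro rfl; exact hpS (Finset.mem_insert_self _ _)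
      exact (h6 p hpq).trans ((h2 p).2 fun h => hpS (Finset.mem_insert_of_mem h))

theorem intCast_isUnit {p : ℕ} [hp : Fact p.Prime] {z : ℤ} (h : ¬ (p : ℤ) ∣ z) : IsUnit (z : ℤ_[p]) := by
  by_contra hc
  exact h ((PadicInt.norm_int_lt_one_iff_dvd z).1 (PadicInt.not_isUnit_iff.1 hc))

theorem iso_of_rp_unit {R : Type*} [CommRing R] {K A : Matrix ι ι R} (h : Rp K A) (hA : IsUnit A.det) : Iso K A := by
  obtain ⟨T, rfl⟩ := h
  refine iso_of_unit (U := T) ?_ rfl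
  rw [det_mul] at hA
  exact isUnit_of_mul_isUnit_right hA

theorem buried_zero {A B : Matrix ι ι ℤ} (hA : PD A) (hB : PD B)
    (h : ∀ p [Fact p.Prime], ∃ K : Matrix ι ι ℤ_[p], Rp K (bc p A) ∧ Rp K (bc p B)) :
    ∃ L L' : Matrix ι ι ℤ, PD L ∧ PD L' ∧ Rp L A ∧ Rp L' B ∧ ∀ p [Fact p.Prime], Iso (bc p L) (bc p L') := by
  choose K hKA hKB using h
  let S := (A.det * B.det).natAbs.primeFactors
  have hS : ∀ p ∈ S, p.Prime := fun p hp => Nat.prime_of_mem_primeFactors hp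
  obtain ⟨L, h1, h2, h3⟩ := glue S hS hA K (fun p _ _ => hKA p)
  obtain ⟨L', h1', h2', h3'⟩ := glue S hS hB K (fun p _ _ => hKB p)
  refine ⟨L, L', h1, h1', h2, h2', ?_⟩
  intro p hp
  by_cases hpS : p ∈ S
  · exact ((h3 p).1 hpS).trans ((h3' p).1 hpS).symm
  · have hnd : ¬ (p : ℤ) ∣ A.det * B.det := by
      intro hd
      apply hpS
      rw [Nat.mem_primeFactors]
      exact ⟨hp.out, Int.natCast_dvd.1 hd, by simp [hA.det_ne, hB.det_ne]⟩
    have uA : IsUnit (bc p A).det := by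
      rw [bc_det]; exact intCast_isUnit fun h => hnd (Dvd.dvd.mul_right h _)
    have uB : IsUnit (bc p B).det := by
      rw [bc_det]; exact intCast_isUnit fun h => hnd (Dvd.dvd.mul_left h _)
    exact ((h3 p).2 hpS).trans ((iso_of_rp_unit (hKA p) uA).symm.trans
      ((iso_of_rp_unit (hKB p) uB).trans ((h3' p).2 hpS).symm))
end PartG
section PartE
variable {ι κ : Type} [Fintype ι] [DecidableEq ι] [Fintype κ] [DecidableEq κ]

theorem diag_exists {A : Matrix κ κ ℤ} (hA : PD A) :
    ∃ (P : Matrix κ κ ℤ) (c : κ → ℕ), P.det ≠ 0 ∧ (∀ i, 0 < c i) ∧ Pᵀ * A * P = diagonal (fun i => (c i : ℤ)) := by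
  classical
  let AQ : Matrix κ κ ℚ := A.map (Int.cast : ℤ → ℚ)
  have hAQ : AQ.IsSymm := by
    ext i j; simp only [AQ, transpose_apply, map_apply]; rw [hA.1.apply]
  let B := Matrix.toBilin' AQ
  have hB : LinearMap.IsSymm B := by
    refine ⟨fun x y => ?_⟩
    simp only [B, Matrix.toBilin'_apply', RingHom.id_apply]
    rw [dotProduct_mulVec, ← mulVec_transpose, hAQ, dotProduct_comm]
  haveI : Invertible (2 : ℚ) := invertibleOfNonzero two_ne_zero
  obtain ⟨v0, hv0⟩ := LinearMap.BilinForm.exists_orthogonal_basis hB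
  have hfr : Fintype.card (Fin (Module.finrank ℚ (κ → ℚ))) = Fintype.card κ := by simp
  let e := Fintype.equivOfCardEq hfr
  let v := v0.reindex e
  have hv : ∀ i j, i ≠ j → B (v i) (v j) = 0 := by
    intro i j hij
    simp only [v, Module.Basis.reindex_apply]
    exact hv0 (fun h => hij (e.symm.injective h))
  obtain ⟨⟨D, hD⟩, hDi⟩ := IsLocalization.exist_integer_multiples_of_finite (nonZeroDivisors ℤ)
    (fun ij : κ × κ => v ij.2 ij.1)
  choose P0 hP0 using hDi
  have hD0 : D ≠ 0 := nonZeroDivisors.ne_zero hD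
  let P : Matrix κ κ ℤ := fun i j => P0 (i, j)
  have hP : ∀ i j, (P i j : ℚ) = D * v j i := by
    intro i j
    have := hP0 (i, j)
    simpa [Submonoid.smul_def] using this
  have hcol : ∀ j, (fun i => (P i j : ℚ)) = (D : ℚ) • v j := by
    intro j; ext i; rw [hP]; rfl
  have hPd : P.det ≠ 0 := by
    intro h
    have h1 : (P.map (Int.cast : ℤ → ℚ)).det = 0 := by
      have := (Int.castRingHom ℚ).map_det P
      rw [h] at this
      simpa using this.symm
    obtain ⟨w, hw, hw0⟩ := exists_mulVec_eq_zero_iff.2 h1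
    apply hw
    have h2 : ∑ j, w j • v j = 0 := by
      ext i
      have := congrFun hw0 i
      simp only [mulVec, dotProduct, map_apply, hP] at this
      have h3 : (D : ℚ) * ∑ j, w j * v j i = 0 := by
        rw [Finset.mul_sum]
        simp only [Pi.zero_apply] at this
        rw [← this]
        exact Finset.sum_congr rfl fun j _ => by ring
      have h4 := (mul_eq_zero.1 h3).resolve_left (by exact_mod_cast hD0)
      simpa using h4
    have := Fintype.linearIndependent_iff.1 v.linearIndependent w h2
    ext j; exact this j
  have hoff : ∀ i j, i ≠ j → (Pᵀ * A * P) i j = 0 := by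
    intro i j hij
    have h1 : (((Pᵀ * A * P) i j : ℤ) : ℚ) = B (fun k => (P k i : ℚ)) (fun k => (P k j : ℚ)) := by
      simp only [B, Matrix.toBilin'_apply']
      rw [Matrix.mul_assoc, mul_apply]
      simp only [mul_apply, transpose_apply, dotProduct, mulVec, AQ, map_apply]
      push_cast; rfl
    rw [hcol, hcol, map_smul, map_smul, LinearMap.smul_apply, hv i j hij] at h1
    simpa using h1
  have hpos : ∀ i, 0 < (Pᵀ * A * P) i i := by
    intro i
    have h1 : (Pᵀ * A * P) i i = (P *ᵥ Pi.single i 1) ⬝ᵥ A *ᵥ (P *ᵥ Pi.single i 1) := by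
      rw [mulVec_single_one, Matrix.mul_assoc, mul_apply]
      simp only [mul_apply, transpose_apply, dotProduct, mulVec, col_apply]
    rw [h1]
    apply hA.2
    intro h
    have := hPd (exists_mulVec_eq_zero_iff.1 ⟨Pi.single i 1, by simp, h⟩)
    exact this
  refine ⟨P, fun i => ((Pᵀ * A * P) i i).toNat, hPd, fun i => by simpa using hpos i, ?_⟩
  ext i j
  by_cases hij : i = j
  · subst hij
    rw [diagonal_apply_eq, Int.toNat_of_nonneg (hpos i).le]
  · rw [diagonal_apply_ne _ hij, hoff i j hij]

theorem oddity_local {p : ℕ} [hp : Fact p.Prime] {K : Matrix ι ι ℤ_[p]} (hK : K.IsSymm) (f g : κ → ℕ)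
    (hc : Fintype.card κ = Fintype.card ι) (hf0 : ∀ i, 0 < f i) (hg0 : ∀ i, 0 < g i)
    (hf : Rp K (diagonal fun i => (f i : ℤ_[p]))) (hg : Rp K (diagonal fun i => (g i : ℤ_[p]))) :
    ∑ i, gamN p (f i) = ∑ i, gamN p (g i) := by
  classical
  let KQ : Matrix ι ι ℚ_[p] := K.map (fun x : ℤ_[p] => (x : ℚ_[p]))
  have hKQ : KQ.IsSymm := by
    ext i j; simp only [KQ, transpose_apply, map_apply]; rw [hK.apply]
  let B := Matrix.toBilin' KQ
  have hB : ∀ x y, B x y = B y x := by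
    intro x y
    simp only [B, Matrix.toBilin'_apply']
    rw [dotProduct_mulVec, ← mulVec_transpose, hKQ, dotProduct_comm]
  let e := (Fintype.equivFin κ).symm
  have key : ∀ f : κ → ℕ, (∀ i, 0 < f i) → Rp K (diagonal fun i => (f i : ℤ_[p])) →
      ∃ v : Fin (Fintype.card κ) → (ι → ℚ_[p]), OrthFam B v ∧ ∀ i, B (v i) (v i) = (f (e i) : ℚ_[p]) := by
    intro f hf0 ⟨T, hT⟩
    let v : Fin (Fintype.card κ) → (ι → ℚ_[p]) := fun j i => (T i (e j) : ℚ_[p])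
    have h1 : ∀ i j, B (v i) (v j) = (((diagonal fun i => (f i : ℤ_[p])) (e i) (e j) : ℤ_[p]) : ℚ_[p]) := by
      intro i j
      rw [← hT]
      simp only [B, Matrix.toBilin'_apply']
      rw [Matrix.mul_assoc, mul_apply]
      simp only [mul_apply, transpose_apply, dotProduct, mulVec, KQ, map_apply]
      simp only [PadicInt.coe_sum, PadicInt.coe_mul]; rfl
    have h2 : ∀ i, B (v i) (v i) = (f (e i) : ℚ_[p]) := by
      intro i; rw [h1, diagonal_apply_eq]; simp
    refine ⟨v, ⟨?_, ?_⟩, h2⟩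
    · intro i j hij
      rw [h1, diagonal_apply_ne _ (fun h => hij (e.injective h))]; simp
    · intro i; rw [h2]; exact_mod_cast (hf0 _).ne'
  obtain ⟨v, hv, hvf⟩ := key f hf0 hf
  obtain ⟨w, hw, hwg⟩ := key g hg0 hg
  have hli : LinearIndependent ℚ_[p] v := by
    rw [Fintype.linearIndependent_iff]
    intro c hc i
    have h1 : B (∑ j, c j • v j) (v i) = 0 := by rw [hc]; simp
    rw [map_sum, LinearMap.sum_apply, Finset.sum_eq_single i] at h1
    · rw [map_smul, LinearMap.smul_apply, smul_eq_mul] at h1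
      exact (mul_eq_zero.1 h1).resolve_right (hv.2 i)
    · intro j _ hji
      rw [map_smul, LinearMap.smul_apply, hv.1 j i hji, smul_zero]
    · simp
  have hspan : Submodule.span ℚ_[p] (Set.range v) = ⊤ :=
    hli.span_eq_top_of_card_eq_finrank' (by simp [hc])
  have := orth_inv (gam_GW p) (by norm_num) B hB _ v w hv hw (fun i => by rw [hspan]; trivial)
  simp only [hvf, hwg, ← gamN_eq] at this
  rw [← Equiv.sum_comp e (fun i => gamN p (f i)), ← Equiv.sum_comp e (fun i => gamN p (g i))]
  exact this

/-- buried over `ℤ_p` -/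
def Bur (p : ℕ) [Fact p.Prime] (n : ℕ) (A B : Matrix κ κ ℤ) : Prop :=
  ∃ K : Matrix (Fin n) (Fin n) ℤ_[p], K.IsSymm ∧ K.det ≠ 0 ∧ Rp K (bc p A) ∧ Rp K (bc p B)

theorem Bur.swap {p : ℕ} [Fact p.Prime] {n : ℕ} {A B : Matrix κ κ ℤ} (h : Bur p n A B) : Bur p n B A := by
  obtain ⟨K, h1, h2, h3, h4⟩ := h; exact ⟨K, h1, h2, h4, h3⟩

theorem bur_of {p : ℕ} [Fact p.Prime] {n : ℕ} {A B : Matrix κ κ ℤ} (K : Matrix ι ι ℤ_[p])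
    (hc : Fintype.card ι = n) (hK : K.IsSymm) (hd : K.det ≠ 0) (h1 : Rp K (bc p A)) (h2 : Rp K (bc p B)) :
    Bur p n A B := by
  let e := (Fintype.equivFinOfCardEq hc).symm
  have hi := iso_reindex e K
  exact ⟨K.submatrix e e, hi.rp.symm hK, by rwa [det_submatrix_equiv_self], hi.symm.rp.trans h1,
    hi.symm.rp.trans h2⟩

theorem bc_dsum (p : ℕ) [Fact p.Prime] (A : Matrix κ κ ℤ) (a : ℤ) :
    bc p (dsum A (un a)) = dsum (bc p A) (un (a : ℤ_[p])) := by
  unfold dsum bc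
  rw [fromBlocks_map]
  congr 1 <;> ext <;> simp

theorem PD.dsum {A : Matrix κ κ ℤ} (hA : PD A) {a : ℤ} (ha : 0 < a) : PD (dsum A (un a)) := by
  refine ⟨dsum_symm hA.1 (un_symm a), ?_⟩
  intro x hx
  have h1 : x ⬝ᵥ (_root_.dsum A (un a)) *ᵥ x = (x ∘ Sum.inl) ⬝ᵥ A *ᵥ (x ∘ Sum.inl) + a * x (Sum.inr ()) ^ 2 := by
    simp [_root_.dsum, dotProduct, mulVec, un]
    ring
  rw [h1]
  by_cases h2 : x ∘ Sum.inl = 0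
  · have h3 : x (Sum.inr ()) ≠ 0 := by
      intro h3
      apply hx
      ext (i | i)
      · exact congrFun h2 i
      · exact h3
    rw [h2]; simp; positivity
  · have := hA.2 _ h2
    positivity

theorem rp_scale {R : Type*} [CommRing R] {K : Matrix ι ι R} {A : Matrix κ κ R} {α : R} (h : Rp K (dsum A (un α))) (s : R) :
    Rp K (dsum A (un (α * s ^ 2))) :=
  h.trans ((Rp.refl A).dsum (un_sq α s))

theorem bur_unit {p : ℕ} [hp : Fact p.Prime] (h2 : p ≠ 2) {n : ℕ} {A B : Matrix κ κ ℤ} (hsA : A.IsSymm) (hsB : B.IsSymm)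
    (hn : Fintype.card κ + 2 ≤ n)
    (hA : IsUnit (A.det : ℤ_[p])) (hB : IsUnit (B.det : ℤ_[p])) {a b : ℤ} (ha : a ≠ 0) (hb : IsUnit (b : ℤ_[p])) :
    Bur p n (dsum A (un a)) (dsum B (un b)) := by
  have sA := bc_symm p hsA
  have sB := bc_symm p hsB
  let d : ℤ_[p] := A.det * B.det * b
  have hdu : IsUnit d := (hA.mul hB).mul hb
  have ha' : (a : ℤ_[p]) ≠ 0 := by exact_mod_cast ha
  obtain ⟨w, hw⟩ := isUnit_iff_exists_inv.1 hA
  refine bur_of (ι := ((κ ⊕ Unit) ⊕ Unit) ⊕ Fin (n - (Fintype.card κ + 2)))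
    (dsum (dsum (dsum (bc p A) (un (a : ℤ_[p]))) (un d)) 1) (by simp; omega)
    (dsum_symm (dsum_symm (dsum_symm sA (un_symm _)) (un_symm _)) (by simp)) ?_ ?_ ?_
  · rw [det_dsum, det_dsum, det_dsum, det_un, det_un, det_one, bc_det, mul_one]
    exact mul_ne_zero (mul_ne_zero hA.ne_zero ha') hdu.ne_zero
  · rw [bc_dsum]
    exact (dsum_left _ _).trans (dsum_left _ _)
  · rw [bc_dsum]
    refine (dsum_left _ _).trans (((dsum_left _ _).dsum (Rp.refl _)).trans (Iso.rp ?_))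
    refine unimod_iso h2 (Fintype.card κ + 1) _ _ _ _ (by simp) (by simp) (dsum_symm sA (un_symm _))
      (dsum_symm sB (un_symm _)) ?_ w (IsUnit.of_mul_eq_one _ (by rw [mul_comm]; exact hw)) ?_
    · rw [det_dsum, det_un, bc_det]; exact hA.mul hdu
    · rw [det_dsum, det_un, bc_det, det_dsum, det_un, bc_det]
      linear_combination (-(A.det : ℤ_[p]) * w - 1) * B.det * b * hw

theorem step_two {n : ℕ} {A B : Matrix κ κ ℤ} (hA : PD A) (hB : PD B) (hn : Fintype.card κ + 2 ≤ n)
    (h : ∀ p [Fact p.Prime], Bur p n A B) :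
    ∃ a b : ℤ, 0 < a ∧ 0 < b ∧ ∀ p [Fact p.Prime], Bur p n (dsum A (un a)) (dsum B (un b)) := by
  choose K hKs hKd hKA hKB using h
  have hdA : ∀ p [Fact p.Prime], (bc p A).det ≠ 0 := fun p _ => by
    rw [bc_det]; exact_mod_cast hA.det_ne
  have hdB : ∀ p [Fact p.Prime], (bc p B).det ≠ 0 := fun p _ => by
    rw [bc_det]; exact_mod_cast hB.det_ne
  have hα := fun p [Fact p.Prime] => local_vec (by norm_num) (hKs p) (hKd p) (hdA p) (hKA p) (by simp; omega)
  have hβ := fun p [Fact p.Prime] => local_vec (by norm_num) (hKs p) (hKd p) (hdB p) (hKB p) (by simp; omega)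
  choose α hα0 hα using hα
  choose β hβ0 hβ using hβ
  let S := (2 * A.det * B.det).natAbs.primeFactors
  have hS : ∀ p ∈ S, p.Prime := fun p hp => Nat.prime_of_mem_primeFactors hp
  obtain ⟨M, q, hM, hq, _, hqS, hMS, h1⟩ := dirichlet_lemma S hS α (fun p _ _ => hα0 p) 0
  obtain ⟨M', q', hM', hq', hqq, hqS', hMS', h1'⟩ := dirichlet_lemma S hS β (fun p _ _ => hβ0 p) (M * q)
  have hpos : 0 < M * q := Nat.mul_pos hM hq.pos
  have hpos' : 0 < M' * q' := Nat.mul_pos hM' hq'.pos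
  refine ⟨(M * q : ℕ), (M' * q' : ℕ), by exact_mod_cast hpos, by exact_mod_cast hpos', ?_⟩
  intro p hp
  by_cases hpS : p ∈ S
  · obtain ⟨s, hs⟩ := h1 p hpS
    obtain ⟨t, ht⟩ := h1' p hpS
    refine ⟨K p, hKs p, hKd p, ?_, ?_⟩
    · rw [bc_dsum, Int.cast_natCast, hs]; exact rp_scale (hα p) s
    · rw [bc_dsum, Int.cast_natCast, ht]; exact rp_scale (hβ p) t
  · have hnd : ¬ (p : ℤ) ∣ 2 * A.det * B.det := by
      intro hd
      apply hpS
      rw [Nat.mem_primeFactors]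
      exact ⟨hp.out, Int.natCast_dvd.1 hd, by simp [hA.det_ne, hB.det_ne]⟩
    have uA : IsUnit (A.det : ℤ_[p]) := intCast_isUnit fun h => hnd ((h.mul_left _).mul_right _)
    have uB : IsUnit (B.det : ℤ_[p]) := intCast_isUnit fun h => hnd (h.mul_left _)
    have h2 : p ≠ 2 := by rintro rfl; exact hnd (((dvd_refl _).mul_right _).mul_right _)
    have hdv : ∀ M q : ℕ, 0 < M → q.Prime → M.primeFactors ⊆ S → p ∣ M * q → p = q := by
      intro M q hM hq hMS hd
      rcases (hp.out.dvd_mul).1 hd with h | h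
      · exact absurd (hMS (Nat.mem_primeFactors.2 ⟨hp.out, h, hM.ne'⟩)) hpS
      · exact (Nat.prime_dvd_prime_iff_eq hp.out hq).1 h
    by_cases hb : p ∣ M' * q'
    · have e1 := hdv M' q' hM' hq' hMS' hb
      have ha : ¬ p ∣ M * q := by
        intro ha
        have e2 := hdv M q hM hq hMS ha
        have : q ≤ M * q := Nat.le_mul_of_pos_left q hM
        omega
      exact (bur_unit h2 hB.1 hA.1 hn uB uA (by exact_mod_cast hpos'.ne')
        (by rw [Int.cast_natCast]; exact natCast_isUnit ha)).swap
    · exact bur_unit h2 hA.1 hB.1 hn uA uB (by exact_mod_cast hpos.ne')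
        (by rw [Int.cast_natCast]; exact natCast_isUnit hb)
end PartE
section PartF
variable {ι κ : Type} [Fintype ι] [DecidableEq ι] [Fintype κ] [DecidableEq κ]

theorem diag_rp {p : ℕ} [Fact p.Prime] {K : Matrix ι ι ℤ_[p]} {A : Matrix κ κ ℤ} {c : κ → ℕ} {a : ℕ}
    (h : Rp K (dsum (bc p A) (un (a : ℤ_[p])))) (hA : Rp A (diagonal fun i => (c i : ℤ))) :
    Rp K (diagonal fun i : κ ⊕ Unit => ((Sum.elim c (fun _ => a) i : ℕ) : ℤ_[p])) := by
  have h1 := h.trans ((hA.bc (p := p)).dsum (Rp.refl (un (a : ℤ_[p]))))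
  convert h1 using 1
  ext (i | i) (j | j)
  · by_cases hij : i = j
    · subst hij; simp [dsum, bc]
    · have : (Sum.inl i : κ ⊕ Unit) ≠ Sum.inl j := fun h => hij (Sum.inl.inj h)
      rw [diagonal_apply_ne _ this]
      simp [dsum, bc, diagonal_apply_ne _ hij]
  · simp [dsum]
  · simp [dsum]
  · simp [dsum, un]

theorem rp_det_sq {R : Type*} [CommRing R] {K : Matrix ι ι R} {A : Matrix κ κ R}
    (hc : Fintype.card κ = Fintype.card ι) (h : Rp K A) : ∃ t, A.det = K.det * t ^ 2 := by
  obtain ⟨T, hT⟩ := h.trans (iso_reindex (Fintype.equivOfCardEq hc).symm A).rp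
  refine ⟨T.det, ?_⟩
  have := congrArg det hT
  rw [det_submatrix_equiv_self, det_mul, det_mul, det_transpose] at this
  rw [← this]; ring

theorem det_diag {A P : Matrix κ κ ℤ} {c : κ → ℕ} (h : Pᵀ * A * P = diagonal (fun i => (c i : ℤ))) :
    A.det * P.det ^ 2 = ((∏ i, c i : ℕ) : ℤ) := by
  have := congrArg det h
  rw [det_mul, det_mul, det_transpose, det_diagonal] at this
  push_cast
  rw [← this]; ring

theorem step_one {n : ℕ} {A B : Matrix κ κ ℤ} (hA : PD A) (hB : PD B) (hn : Fintype.card κ + 1 = n)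
    (h : ∀ p [Fact p.Prime], Bur p n A B) :
    ∃ a b : ℤ, 0 < a ∧ 0 < b ∧ ∀ p [Fact p.Prime], Bur p n (dsum A (un a)) (dsum B (un b)) := by
  obtain ⟨P, c, hP, hc0, hPA⟩ := diag_exists hA
  obtain ⟨Q, e, hQ, he0, hQB⟩ := diag_exists hB
  have hdc := det_diag hPA
  have hde := det_diag hQB
  have hc1 : 0 < ∏ i, c i := Finset.prod_pos fun i _ => hc0 i
  have he1 : 0 < ∏ i, e i := Finset.prod_pos fun i _ => he0 i
  have hA1 : 0 < A.det := by
    have : 0 < A.det * P.det ^ 2 := by rw [hdc]; exact_mod_cast hc1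
    exact pos_of_mul_pos_left this (by positivity)
  have hB1 : 0 < B.det := by
    have : 0 < B.det * Q.det ^ 2 := by rw [hde]; exact_mod_cast he1
    exact pos_of_mul_pos_left this (by positivity)
  obtain ⟨d1, hd1⟩ := Int.eq_ofNat_of_zero_le hA1.le
  obtain ⟨d2, hd2⟩ := Int.eq_ofNat_of_zero_le hB1.le
  have hd1p : 0 < d1 := by rw [hd1] at hA1; exact_mod_cast hA1
  have hd2p : 0 < d2 := by rw [hd2] at hB1; exact_mod_cast hB1
  choose K hKs hKd hKA hKB using h
  have hdA : ∀ p [Fact p.Prime], (bc p A).det = (d1 : ℤ_[p]) := fun p _ => by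
    rw [bc_det, hd1]; simp
  have hdB : ∀ p [Fact p.Prime], (bc p B).det = (d2 : ℤ_[p]) := fun p _ => by
    rw [bc_det, hd2]; simp
  have hα := fun p [Fact p.Prime] => local_vec (by norm_num) (hKs p) (hKd p)
    (by rw [hdA]; exact_mod_cast hd1p.ne') (hKA p) (by simp; omega)
  have hβ := fun p [Fact p.Prime] => local_vec (by norm_num) (hKs p) (hKd p)
    (by rw [hdB]; exact_mod_cast hd2p.ne') (hKB p) (by simp; omega)
  choose α hα0 hα using hα
  choose β hβ0 hβ using hβ
  have hρ : ∀ p [Fact p.Prime], ∃ ρ : ℤ_[p], (d1 : ℤ_[p]) * d2 * (α p * β p ^ 2) = β p * ρ ^ 2 := by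
    intro p _
    obtain ⟨t1, ht1⟩ := rp_det_sq (by simp; omega) (hα p)
    obtain ⟨t2, ht2⟩ := rp_det_sq (by simp; omega) (hβ p)
    rw [det_dsum, det_un, hdA] at ht1
    rw [det_dsum, det_un, hdB] at ht2
    refine ⟨(K p).det * t1 * t2, ?_⟩
    linear_combination (d2 * β p ^ 2) * ht1 + (K p).det * t1 ^ 2 * β p * ht2
  choose ρ hρ using hρ
  let N := 2 * d1 * d2 * (∏ i, c i) * (∏ i, e i)
  have hN : N ≠ 0 := by positivity
  let S := N.primeFactors
  have hS : ∀ p ∈ S, p.Prime := fun p hp => Nat.prime_of_mem_primeFactors hp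
  have hSd : ∀ x, x ∣ N → x.primeFactors ⊆ S := fun x hx => Nat.primeFactors_mono hx hN
  have h2S : 2 ∈ S := Nat.mem_primeFactors.2 ⟨Nat.prime_two, ⟨d1 * d2 * (∏ i, c i) * (∏ i, e i), by simp only [N]; ring⟩, hN⟩
  have hd1S : d1.primeFactors ⊆ S := hSd _ ⟨2 * d2 * (∏ i, c i) * (∏ i, e i), by simp only [N]; ring⟩
  have hd2S : d2.primeFactors ⊆ S := hSd _ ⟨2 * d1 * (∏ i, c i) * (∏ i, e i), by simp only [N]; ring⟩
  have hcS : ∀ i, (c i).primeFactors ⊆ S := fun i =>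
    hSd _ ((Finset.dvd_prod_of_mem c (Finset.mem_univ i)).trans
      ⟨2 * d1 * d2 * (∏ i, e i), by simp only [N]; ring⟩)
  have heS : ∀ i, (e i).primeFactors ⊆ S := fun i =>
    hSd _ ((Finset.dvd_prod_of_mem e (Finset.mem_univ i)).trans
      ⟨2 * d1 * d2 * (∏ i, c i), by simp only [N]; ring⟩)
  obtain ⟨M, q, hM, hq, _, hqS, hMS, h1⟩ := dirichlet_lemma S hS (fun p _ => α p * β p ^ 2)
    (fun p _ _ => mul_ne_zero (hα0 p) (pow_ne_zero _ (hβ0 p))) 0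
  have hndiv : ∀ {p x : ℕ}, p.Prime → p ∉ S → x ≠ 0 → x.primeFactors ⊆ S → ¬ p ∣ x := by
    intro p x hp hpS hx hxS hd
    exact hpS (hxS (Nat.mem_primeFactors.2 ⟨hp, hd, hx⟩))
  have hapos : 0 < M * q := Nat.mul_pos hM hq.pos
  have hbpos : 0 < d1 * d2 * (M * q) := Nat.mul_pos (Nat.mul_pos hd1p hd2p) hapos
  -- representations at primes of S
  have hrA : ∀ p [Fact p.Prime], p ∈ S → Rp (K p) (dsum (bc p A) (un ((M * q : ℕ) : ℤ_[p]))) := by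
    intro p _ hpS
    obtain ⟨s, hs⟩ := h1 p hpS
    rw [hs, mul_assoc, ← mul_pow]
    exact rp_scale (hα p) _
  have hrB : ∀ p [Fact p.Prime], p ∈ S → Rp (K p) (dsum (bc p B) (un ((d1 * d2 * (M * q) : ℕ) : ℤ_[p]))) := by
    intro p _ hpS
    obtain ⟨s, hs⟩ := h1 p hpS
    have : ((d1 * d2 * (M * q) : ℕ) : ℤ_[p]) = β p * (ρ p * s) ^ 2 := by
      rw [Nat.cast_mul, hs, Nat.cast_mul]
      linear_combination s ^ 2 * hρ p
    rw [this]
    exact rp_scale (hβ p) _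
  have hq2 : q ≠ 2 := by rintro rfl; exact hqS h2S
  have hqM : ¬ q ∣ M := hndiv hq hqS hM.ne' hMS
  have hqd1 : ¬ q ∣ d1 := hndiv hq hqS hd1p.ne' hd1S
  have hqd2 : ¬ q ∣ d2 := hndiv hq hqS hd2p.ne' hd2S
  have hqd : ¬ q ∣ d1 * d2 := by
    intro h; rcases hq.dvd_mul.1 h with h | h
    · exact hqd1 h
    · exact hqd2 h
  -- product formula
  have htJ : tJ (d1 * d2) q = 0 := by
    let f : κ ⊕ Unit → ℕ := Sum.elim c (fun _ => M * q)
    let g : κ ⊕ Unit → ℕ := Sum.elim e (fun _ => d1 * d2 * (M * q))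
    have hf0 : ∀ i, 0 < f i := by
      rintro (i | i)
      · exact hc0 i
      · exact hapos
    have hg0 : ∀ i, 0 < g i := by
      rintro (i | i)
      · exact he0 i
      · exact hbpos
    have hT : ∀ p ∈ insert q S, p.Prime := by
      intro p hp
      rcases Finset.mem_insert.1 hp with rfl | hp
      · exact hq
      · exact hS p hp
    have hMqS : (M * q).primeFactors ⊆ insert q S := by
      rw [Nat.primeFactors_mul hM.ne' hq.ne_zero, hq.primeFactors]
      intro x hx
      rcases Finset.mem_union.1 hx with hx | hx
      · exact Finset.mem_insert_of_mem (hMS hx)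
      · rw [Finset.mem_singleton.1 hx]; exact Finset.mem_insert_self _ _
    have hfS : ∀ i, (f i).primeFactors ⊆ insert q S := by
      rintro (i | i)
      · exact (hcS i).trans (Finset.subset_insert _ _)
      · exact hMqS
    have hgS : ∀ i, (g i).primeFactors ⊆ insert q S := by
      rintro (i | i)
      · exact (heS i).trans (Finset.subset_insert _ _)
      · change (d1 * d2 * (M * q)).primeFactors ⊆ _
        rw [Nat.primeFactors_mul (Nat.mul_pos hd1p hd2p).ne' hapos.ne', Nat.primeFactors_mul hd1p.ne' hd2p.ne']
        exact Finset.union_subset ((Finset.union_subset hd1S hd2S).trans (Finset.subset_insert _ _)) hMqS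
    have tf : ∑ p ∈ insert q S, ∑ i, gamN p (f i) = ∑ p ∈ insert q S, ∑ i, gamN p (g i) := by
      rw [Finset.sum_comm, Finset.sum_comm (s := insert q S)]
      refine Finset.sum_congr rfl fun i _ => ?_
      rw [gamN_sum _ hT (Finset.mem_insert_of_mem h2S) _ (hf0 i).ne' (hfS i),
        gamN_sum _ hT (Finset.mem_insert_of_mem h2S) _ (hg0 i).ne' (hgS i)]
    have tS : ∑ p ∈ S, ∑ i, gamN p (f i) = ∑ p ∈ S, ∑ i, gamN p (g i) := by
      refine Finset.sum_congr rfl fun p hpS => ?_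
      haveI : Fact p.Prime := ⟨hS p hpS⟩
      exact oddity_local (hKs p) f g (by simp; omega) hf0 hg0 (diag_rp (hrA p hpS) ⟨P, hPA⟩)
        (diag_rp (hrB p hpS) ⟨Q, hQB⟩)
    rw [Finset.sum_insert hqS, Finset.sum_insert hqS, tS] at tf
    have tq := add_right_cancel tf
    rw [Fintype.sum_sum_type, Fintype.sum_sum_type] at tq
    simp only [f, g, Sum.elim_inl, Sum.elim_inr, Finset.univ_unique, Finset.sum_singleton] at tq
    rw [Finset.sum_eq_zero (fun i _ => gamN_unit q (c i) hq hq2 (hndiv hq hqS (hc0 i).ne' (hcS i))),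
      Finset.sum_eq_zero (fun i _ => gamN_unit q (e i) hq hq2 (hndiv hq hqS (he0 i).ne' (heS i))),
      zero_add, zero_add, show d1 * d2 * (M * q) = q * (d1 * d2 * M) by ring, mul_comm M q,
      gamN_p q M hq hq2 hqM, gamN_p q _ hq hq2 (by
        intro h; rcases hq.dvd_mul.1 h with h | h
        · exact hqd h
        · exact hqM h),
      tJ_mul _ _ _ ((hq.coprime_iff_not_dvd.2 hqd).symm) ((hq.coprime_iff_not_dvd.2 hqM).symm)] at tq
    have := add_left_cancel tq
    simpa using this
  refine ⟨(M * q : ℕ), (d1 * d2 * (M * q) : ℕ), by exact_mod_cast hapos, by exact_mod_cast hbpos, ?_⟩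
  intro p hp
  have sA := bc_symm p hA.1
  have sB := bc_symm p hB.1
  by_cases hpS : p ∈ S
  · refine ⟨K p, hKs p, hKd p, ?_, ?_⟩
    · rw [bc_dsum, Int.cast_natCast]; exact hrA p hpS
    · rw [bc_dsum, Int.cast_natCast]; exact hrB p hpS
  have hp2 : p ≠ 2 := by rintro rfl; exact hpS h2S
  have u1 : IsUnit (d1 : ℤ_[p]) := natCast_isUnit (hndiv hp.out hpS hd1p.ne' hd1S)
  have u2 : IsUnit (d2 : ℤ_[p]) := natCast_isUnit (hndiv hp.out hpS hd2p.ne' hd2S)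
  suffices hiso : Iso (dsum (bc p A) (un ((M * q : ℕ) : ℤ_[p])))
      (dsum (bc p B) (un ((d1 * d2 * (M * q) : ℕ) : ℤ_[p]))) by
    refine bur_of (dsum (bc p A) (un ((M * q : ℕ) : ℤ_[p]))) (by simp; omega) (dsum_symm sA (un_symm _)) ?_ ?_ ?_
    · rw [det_dsum, det_un, hdA]; exact_mod_cast (Nat.mul_pos hd1p hapos).ne'
    · rw [bc_dsum, Int.cast_natCast]; exact Rp.refl _
    · rw [bc_dsum, Int.cast_natCast]; exact hiso.rp
  by_cases hpq : p = q
  · subst hpq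
    have hj : jacobiSym (d1 * d2 : ℕ) p = 1 := by
      rcases jacobiSym.eq_one_or_neg_one (a := ((d1 * d2 : ℕ) : ℤ)) (b := p)
        (by rw [Int.gcd_natCast_natCast]; exact (hq.coprime_iff_not_dvd.2 hqd).symm) with h | h
      · exact h
      · rw [tJ, h] at htJ
        exact absurd htJ (by decide)
    have hsq : IsSquare (PadicInt.toZMod ((d1 * d2 : ℕ) : ℤ_[p])) := by
      rw [← jacobiSym.legendreSym.to_jacobiSym, legendreSym.eq_one_iff'] at hj
      · rw [map_natCast]; exact hj
      · rw [Ne, ZMod.natCast_eq_zero_iff]; exact hqd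
    obtain ⟨r, hr, hr2⟩ := sq_odd hp2 _ (natCast_isUnit hqd) hsq
    obtain ⟨w, hw⟩ := isUnit_iff_exists_inv.1 u1
    have hAB : Iso (bc p A) (bc p B) := by
      refine unimod_iso hp2 _ _ _ _ _ rfl rfl sA sB (by rw [hdA]; exact u1) (r * w)
        (hr.mul (IsUnit.of_mul_eq_one _ (by rw [mul_comm]; exact hw))) ?_
      rw [hdA, hdB, mul_pow, ← hr2]
      push_cast
      linear_combination (-(d1 : ℤ_[p]) * w - 1) * d2 * hw
    have e1 : ((d1 * d2 * (M * p) : ℕ) : ℤ_[p]) = ((M * p : ℕ) : ℤ_[p]) * r ^ 2 := by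
      rw [← hr2]; push_cast; ring
    rw [e1]
    exact hAB.dsum (un_iso _ _ hr)
  · have u3 : IsUnit ((M * q : ℕ) : ℤ_[p]) := natCast_isUnit (by
      intro h; rcases hp.out.dvd_mul.1 h with h | h
      · exact hndiv hp.out hpS hM.ne' hMS h
      · exact hpq ((Nat.prime_dvd_prime_iff_eq hp.out hq).1 h))
    refine unimod_iso hp2 _ _ _ _ _ rfl rfl (dsum_symm sA (un_symm _)) (dsum_symm sB (un_symm _)) ?_ (d2 : ℤ_[p]) u2 ?_
    · rw [det_dsum, det_un, hdA]; exact u1.mul u3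
    · rw [det_dsum, det_un, det_dsum, det_un, hdA, hdB]; push_cast; ring

theorem main_ind (k : ℕ) : ∀ (n : ℕ) (κ : Type) [Fintype κ] [DecidableEq κ] (A B : Matrix κ κ ℤ), PD A → PD B →
    Fintype.card κ + k = n → (∀ p [Fact p.Prime], Bur p n A B) →
    ∃ (μ : Type) (_ : Fintype μ) (_ : DecidableEq μ) (L L' : Matrix μ μ ℤ), Fintype.card μ = n ∧ PD L ∧ PD L' ∧
      Rp L A ∧ Rp L' B ∧ ∀ p [Fact p.Prime], Iso (bc p L) (bc p L') := by
  induction k with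
  | zero =>
    intro n κ _ _ A B hA hB hn h
    obtain ⟨L, L', h1, h2, h3, h4, h5⟩ := buried_zero hA hB (by
      intro p _
      obtain ⟨K, hs, hd, hKA, hKB⟩ := h p
      have hi := iso_reindex (Fintype.equivFinOfCardEq (by omega : Fintype.card κ = n)) K
      exact ⟨_, hi.symm.rp.trans hKA, hi.symm.rp.trans hKB⟩)
    exact ⟨κ, inferInstance, inferInstance, L, L', by omega, h1, h2, h3, h4, h5⟩
  | succ k ih =>
    intro n κ _ _ A B hA hB hn h
    have hs : ∃ a b : ℤ, 0 < a ∧ 0 < b ∧ ∀ p [Fact p.Prime], Bur p n (dsum A (un a)) (dsum B (un b)) := by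
      rcases Nat.eq_zero_or_pos k with rfl | hk
      · exact step_one hA hB hn h
      · exact step_two hA hB (by omega) h
    obtain ⟨a, b, ha, hb, hab⟩ := hs
    obtain ⟨μ, i1, i2, L, L', h0, h1, h2, h3, h4, h5⟩ :=
      ih n (κ ⊕ Unit) _ _ (hA.dsum ha) (hB.dsum hb) (by simp; omega) hab
    exact ⟨μ, i1, i2, L, L', h0, h1, h2, h3.trans (dsum_left _ _), h4.trans (dsum_left _ _), h5⟩

theorem PD.reindex {A : Matrix κ κ ℤ} (hA : PD A) (e : ι ≃ κ) : PD (A.submatrix e e) := by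
  refine ⟨hA.1.submatrix e, fun x hx => ?_⟩
  have h1 : x ∘ e.symm ≠ 0 := by
    intro h
    apply hx
    ext i
    simpa using congrFun h (e i)
  have h2 := hA.2 _ h1
  have h3 : x ⬝ᵥ A.submatrix e e *ᵥ x = (x ∘ e.symm) ⬝ᵥ A *ᵥ (x ∘ e.symm) := by
    rw [submatrix_mulVec_equiv, comp_equiv_symm_dotProduct]
  rw [h3]; exact h2

theorem main_fin {m n : ℕ} (hmn : m ≤ n) {A B : Matrix (Fin m) (Fin m) ℤ} (hA : PD A) (hB : PD B)
    (h : ∀ p [Fact p.Prime], Bur p n A B) :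
    ∃ L L' : Matrix (Fin n) (Fin n) ℤ, PD L ∧ PD L' ∧ Rp L A ∧ Rp L' B ∧
      ∀ p [Fact p.Prime], Iso (bc p L) (bc p L') := by
  obtain ⟨μ, _, _, L, L', h0, h1, h2, h3, h4, h5⟩ := main_ind (n - m) n (Fin m) A B hA hB (by simp; omega) h
  let e := (Fintype.equivFinOfCardEq h0).symm
  refine ⟨L.submatrix e e, L'.submatrix e e, h1.reindex e, h2.reindex e, (iso_reindex e L).symm.rp.trans h3,
    (iso_reindex e L').symm.rp.trans h4, fun p _ => ?_⟩
  exact ((iso_reindex e (bc p L)).symm.trans (h5 p)).trans (iso_reindex e (bc p L'))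
end PartF

/-- For positive definite forms ℓ₁, ℓ₂ of rank m ≤ n (not necessarily even): the pair is
buried in rank n over ℤ_p for every prime p iff it is buried in a genus of rank n. -/
theorem buried_locally_Zp_iff_buried_in_genus (m n : ℕ) (hm : 0 < m) (hmn : m ≤ n)
    (ℓ₁ ℓ₂ : Matrix (Fin m) (Fin m) ℤ)
    (h₁ : IsPDForm ℓ₁) (h₂ : IsPDForm ℓ₂) :
    (∀ (p : ℕ) [Fact p.Prime], BuriedIn ℤ_[p] n ℓ₁ ℓ₂) ↔
      ∃ L L' : Matrix (Fin n) (Fin n) ℤ, IsPDForm L ∧ IsPDForm L' ∧ SameGenus L L' ∧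
        Represents L ℓ₁ ∧ Represents L' ℓ₂ := by
  constructor
  · intro h
    obtain ⟨L, L', hL, hL', r1, r2, hi⟩ := main_fin hmn (A := ℓ₁) (B := ℓ₂) h₁ h₂ (fun p _ => h p)
    exact ⟨L, L', hL, hL', fun p _ => (hi p).unit, r1, r2⟩
  · rintro ⟨L, L', hL, hL', hg, r1, r2⟩ p hp
    obtain ⟨U, _, hU⟩ := hg p
    have q1 : Rp (bc p L) (bc p ℓ₁) := Rp.bc r1
    have q2 : Rp (bc p L') (bc p ℓ₂) := Rp.bc r2
    have q3 : Rp (bc p L) (bc p L') := ⟨U, hU⟩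
    refine ⟨bc p L, bc_symm p hL.1, ?_, q1, q3.trans q2⟩
    rw [bc_det]
    exact_mod_cast PD.det_ne hL
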